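/- arXiv:2201.02159 — 4 statements merged into one kernel-verified Lean document; each statement's English description precedes it below -/
import Mathlib

section
/- There exists a Hölder continuous function g : [0,1] → ℝ with Hölder exponent log(10)/log(234) such that for every function f : [0,1] → ℝ with f(0) = 0 and total variation V_0^1(f) < 1, the set {t ∈ [0,1] : g(t) = f(t)} is uncountable. -/
open Set
open scoped ENNReal

section Variation

theorem eVariationOn_const_mul_sub_le (c : ℝ) (f g : ℝ → ℝ) (s : Set ℝ) :
    eVariationOn (fun x => c * (f x - g x)) s ≤
      ENNReal.ofReal |c| * (eVariationOn f s + eVariationOn g s) := by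
  refine iSup_le fun p => ?_
  have key : ∀ x y : ℝ, edist (c * (f x - g x)) (c * (f y - g y)) ≤
      ENNReal.ofReal |c| * (edist (f x) (f y) + edist (g x) (g y)) := by
    intro x y
    rw [edist_dist, edist_dist, edist_dist, ← ENNReal.ofReal_add dist_nonneg dist_nonneg,
      ← ENNReal.ofReal_mul (abs_nonneg c)]
    apply ENNReal.ofReal_le_ofReal
    simp only [Real.dist_eq]
    rw [← mul_sub, abs_mul]
    refine mul_le_mul_of_nonneg_left ?_ (abs_nonneg c)
    rw [show f x - g x - (f y - g y) = (f x - f y) - (g x - g y) by ring]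
    exact abs_sub _ _
  calc _ ≤ ∑ i ∈ Finset.range p.1, ENNReal.ofReal |c| *
        (edist (f (p.2.1 (i + 1))) (f (p.2.1 i)) + edist (g (p.2.1 (i + 1))) (g (p.2.1 i))) :=
        Finset.sum_le_sum fun i _ => key _ _
    _ = ENNReal.ofReal |c| * (∑ i ∈ Finset.range p.1, edist (f (p.2.1 (i + 1))) (f (p.2.1 i)) +
        ∑ i ∈ Finset.range p.1, edist (g (p.2.1 (i + 1))) (g (p.2.1 i))) := by
        rw [← Finset.mul_sum, Finset.sum_add_distrib]
    _ ≤ _ := by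
        gcongr
        · exact eVariationOn.sum_le p.2.2.1 p.2.2.2
        · exact eVariationOn.sum_le p.2.2.1 p.2.2.2

theorem LipschitzWith.eVariationOn_Icc_le {h : ℝ → ℝ} {L : NNReal} (hh : LipschitzWith L h)
    (a b : ℝ) : eVariationOn h (Icc a b) ≤ L * ENNReal.ofReal (b - a) := by
  have := (hh.lipschitzOnWith (s := univ)).comp_eVariationOn_le (f := h) (g := id) (s := Icc a b)
    (mapsTo_univ _ _)
  rwa [eVariationOn_id_Icc] at this

theorem abs_sub_lt_of_eVariationOn_lt {f : ℝ → ℝ} {s : Set ℝ} {v x y : ℝ}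
    (hf : eVariationOn f s < ENNReal.ofReal v) (hx : x ∈ s) (hy : y ∈ s) : |f x - f y| < v := by
  have h := (eVariationOn.edist_le f hx hy).trans_lt hf
  rw [edist_dist, Real.dist_eq] at h
  exact (ENNReal.ofReal_lt_ofReal_iff_of_nonneg (abs_nonneg _)).1 h

/-- Among `K` equal pieces of `[0,1]`, one has small variation and avoids a given point. -/
theorem exists_piece_eVariationOn_lt {f : ℝ → ℝ} {K : ℕ} {v : ℝ} (hK : 0 < K)
    (hf : eVariationOn f (Icc 0 1) < 1) (hv : 0 ≤ v) (hKv : 1 ≤ ((K : ℝ) - 2) * v) (c : ℝ) :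
    ∃ i < K, c ∉ Icc ((i : ℝ) / K) ((i + 1) / K) ∧
      eVariationOn f (Icc ((i : ℝ) / K) ((i + 1) / K)) < ENNReal.ofReal v := by
  by_contra! H
  have hK' : (0 : ℝ) < K := by exact_mod_cast hK
  have hsum := eVariationOn.sum' f (I := fun i : ℕ => (i : ℝ) / K)
    (fun i j hij => by dsimp only; gcongr) (n := K)
  have hKK : (K : ℝ) / K = 1 := div_self hK'.ne'
  simp only [Nat.cast_zero, zero_div, hKK, Nat.cast_add, Nat.cast_one] at hsum
  rw [← hsum] at hf
  refine absurd hf (not_lt.2 ?_)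
  set B : Finset ℕ := {⌊K * c⌋₊, ⌊K * c⌋₊ - 1}
  have hB : B.card ≤ 2 := Finset.card_le_two
  have hcard : K - 2 ≤ (Finset.range K \ B).card := by
    have := Finset.le_card_sdiff B (Finset.range K)
    rw [Finset.card_range] at this
    omega
  have hcard' : (K : ℝ) - 2 ≤ (Finset.range K \ B).card := by
    have : K ≤ (Finset.range K \ B).card + 2 := by omega
    have : (K : ℝ) ≤ ((Finset.range K \ B).card + 2 : ℕ) := by exact_mod_cast this
    push_cast at this
    linarith
  calc (1 : ℝ≥0∞) = ENNReal.ofReal 1 := by simp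
    _ ≤ ENNReal.ofReal ((Finset.range K \ B).card * v) :=
        ENNReal.ofReal_le_ofReal (hKv.trans (mul_le_mul_of_nonneg_right hcard' hv))
    _ = ∑ i ∈ Finset.range K \ B, ENNReal.ofReal v := by
        rw [Finset.sum_const, nsmul_eq_mul, ENNReal.ofReal_mul (by positivity),
          ENNReal.ofReal_natCast]
    _ ≤ ∑ i ∈ Finset.range K \ B, eVariationOn f (Icc ((i : ℝ) / K) ((i + 1) / K)) := by
        refine Finset.sum_le_sum fun i hi => ?_
        rw [Finset.mem_sdiff, Finset.mem_range] at hi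
        refine H i hi.1 fun hc => hi.2 ?_
        rw [mem_Icc, div_le_iff₀ hK', le_div_iff₀ hK', mul_comm c] at hc
        have hle : i ≤ ⌊K * c⌋₊ := Nat.le_floor hc.1
        have hle' : ⌊K * c⌋₊ ≤ i + 1 := by
          apply Nat.floor_le_of_le
          push_cast
          exact hc.2
        simp only [B, Finset.mem_insert, Finset.mem_singleton]
        omega
    _ ≤ _ := Finset.sum_le_sum_of_subset Finset.sdiff_subset

end Variation

section Series

/-- The Weierstrass-type series `∑ h (N ^ n * x) / M ^ n`. -/
noncomputable def weierstrassSeries (h : ℝ → ℝ) (M N x : ℝ) : ℝ := ∑' n : ℕ, h (N ^ n * x) / M ^ n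

variable {h : ℝ → ℝ} {M N B L α : ℝ}

theorem summable_weierstrassSeries (hM : 2 ≤ M) (hB : ∀ x, |h x| ≤ B) (x : ℝ) :
    Summable fun n : ℕ => h (N ^ n * x) / M ^ n := by
  have h1 : Summable fun n : ℕ => B * (M⁻¹) ^ n :=
    (summable_geometric_of_lt_one (by positivity) (inv_lt_one_of_one_lt₀ (by linarith))).mul_left B
  refine Summable.of_norm_bounded h1 fun n => ?_
  rw [Real.norm_eq_abs, abs_div, abs_of_pos (by positivity : 0 < M ^ n), inv_pow, div_eq_mul_inv]
  exact mul_le_mul_of_nonneg_right (hB _) (by positivity)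

theorem abs_weierstrassSeries_le (hM : 2 ≤ M) (hB : ∀ x, |h x| ≤ B) (x : ℝ) :
    |weierstrassSeries h M N x| ≤ B * 2 := by
  have hB0 : 0 ≤ B := (abs_nonneg _).trans (hB 0)
  rw [weierstrassSeries, ← Real.norm_eq_abs]
  refine tsum_of_norm_bounded (hasSum_geometric_two.mul_left B) fun n => ?_
  rw [Real.norm_eq_abs, abs_div, abs_of_pos (by positivity : 0 < M ^ n), div_eq_mul_inv, ← inv_pow]
  gcongr
  · exact hB _
  · rw [one_div]
    gcongr

theorem weierstrassSeries_eq (hM : 2 ≤ M) (hB : ∀ x, |h x| ≤ B) (x : ℝ) :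
    weierstrassSeries h M N x = h x + weierstrassSeries h M N (N * x) / M := by
  unfold weierstrassSeries
  rw [(summable_weierstrassSeries hM hB x).tsum_eq_zero_add, ← tsum_div_const]
  congr 1
  · simp
  · refine tsum_congr fun n => ?_
    rw [div_div, ← pow_succ, pow_succ N, mul_assoc]

theorem weierstrassSeries_holder (hM : 2 ≤ M) (hN : 2 * M ≤ N) (hB : ∀ x, |h x| ≤ B)
    (hL : ∀ x y, |h x - h y| ≤ L * |x - y|) (hα : 0 < α) (hNα : N ^ α = M) (x y : ℝ)
    (hxy : |x - y| ≤ 1) :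
    |weierstrassSeries h M N x - weierstrassSeries h M N y| ≤ (4 * B + L * N) * |x - y| ^ α := by
  set g := weierstrassSeries h M N with hg
  have hN1 : 1 < N := by linarith
  have hB0 : 0 ≤ B := (abs_nonneg _).trans (hB 0)
  have hL0 : 0 ≤ L := by simpa using (abs_nonneg _).trans (hL 1 0)
  have hC : 0 ≤ 4 * B + L * N := by positivity
  have main : ∀ k : ℕ, ∀ x y : ℝ, 1 ≤ N ^ k * |x - y| → |x - y| ≤ N →
      |g x - g y| ≤ (4 * B + L * N) * |x - y| ^ α - L * |x - y| := by
    intro k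
    induction k with
    | zero =>
      intro x y h1 h2
      rw [pow_zero, one_mul] at h1
      have e1 : |g x - g y| ≤ 4 * B := by
        refine (abs_sub _ _).trans ?_
        have a1 := abs_weierstrassSeries_le (N := N) hM hB x
        have a2 := abs_weierstrassSeries_le (N := N) hM hB y
        linarith
      have e2 : 1 ≤ |x - y| ^ α := Real.one_le_rpow h1 hα.le
      have e3 := mul_le_mul_of_nonneg_left e2 hC
      have e4 := mul_le_mul_of_nonneg_left h2 hL0
      linarith
    | succ k ih =>
      intro x y h1 h2
      rcases le_or_gt 1 (N ^ k * |x - y|) with h3 | h3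
      · exact ih x y h3 h2
      have hd : |x - y| ≤ 1 := by
        have : 1 ≤ N ^ k := one_le_pow₀ hN1.le
        nlinarith [abs_nonneg (x - y)]
      have hNd : |N * x - N * y| = N * |x - y| := by
        rw [← mul_sub, abs_mul, abs_of_pos (by linarith)]
      have e := ih (N * x) (N * y) (by rw [hNd, ← mul_assoc, ← pow_succ]; exact h1)
        (by rw [hNd]; nlinarith)
      rw [hNd, Real.mul_rpow (by linarith) (abs_nonneg _), hNα] at e
      have hgx : g x = h x + g (N * x) / M := weierstrassSeries_eq hM hB x
      have hgy : g y = h y + g (N * y) / M := weierstrassSeries_eq hM hB y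
      have e1 : |g x - g y| ≤ |h x - h y| + |g (N * x) - g (N * y)| / M := by
        rw [hgx, hgy, show h x + g (N * x) / M - (h y + g (N * y) / M) =
          (h x - h y) + (g (N * x) - g (N * y)) / M by ring]
        refine (abs_add_le _ _).trans_eq ?_
        rw [abs_div, abs_of_pos (by linarith : 0 < M)]
      have e2 : |g (N * x) - g (N * y)| / M ≤
          (4 * B + L * N) * |x - y| ^ α - 2 * (L * |x - y|) := by
        rw [div_le_iff₀ (by linarith)]
        have : 2 * M * (L * |x - y|) ≤ N * (L * |x - y|) := by gcongr
        linarith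
      have e3 := hL x y
      linarith
  rcases eq_or_ne x y with rfl | hne
  · simp only [sub_self, abs_zero]
    positivity
  have hpos : 0 < |x - y| := abs_pos.2 (sub_ne_zero.2 hne)
  obtain ⟨k, hk⟩ := pow_unbounded_of_one_lt (|x - y|)⁻¹ hN1
  have h1 : 1 ≤ N ^ k * |x - y| := by
    rw [inv_lt_iff_one_lt_mul₀ hpos] at hk
    linarith
  have := main k x y h1 (by linarith)
  have : 0 ≤ L * |x - y| := by positivity
  linarith

end Series

section Construction

/-- The wave whose rescaled copies make up the impermeable graph. -/
noncomputable def impermeableWave (x : ℝ) : ℝ := 2 * Real.cos (27378 * Real.pi * x)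

theorem abs_impermeableWave_le (x : ℝ) : |impermeableWave x| ≤ 2 := by
  rw [impermeableWave, abs_mul, abs_two]
  linarith [Real.abs_cos_le_one (27378 * Real.pi * x)]

theorem abs_impermeableWave_sub_le (x y : ℝ) :
    |impermeableWave x - impermeableWave y| ≤ (54756 * Real.pi) * |x - y| := by
  have h1 := Real.lipschitzWith_cos.dist_le_mul (27378 * Real.pi * x) (27378 * Real.pi * y)
  rw [Real.dist_eq, Real.dist_eq, ← mul_sub, abs_mul,
    abs_of_pos (by positivity : (0 : ℝ) < 27378 * Real.pi), NNReal.coe_one, one_mul] at h1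
  rw [impermeableWave, impermeableWave, ← mul_sub, abs_mul, abs_two]
  linarith

theorem continuous_impermeableWave : Continuous impermeableWave := by
  unfold impermeableWave
  fun_prop

theorem impermeableWave_natCast_add (m : ℕ) (x : ℝ) :
    impermeableWave (m + x) = impermeableWave x := by
  unfold impermeableWave
  rw [show 27378 * Real.pi * (m + x) =
    27378 * Real.pi * x + ((13689 * m : ℕ) : ℝ) * (2 * Real.pi) by push_cast; ring,
    Real.cos_add_nat_mul_two_pi]

theorem impermeableWave_div (i : ℕ) : impermeableWave (i / 27378) = 2 * (-1) ^ i := by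
  unfold impermeableWave
  rw [show 27378 * Real.pi * ((i : ℝ) / 27378) = i * Real.pi by ring, Real.cos_nat_mul_pi]

theorem lipschitzWith_impermeableWave :
    LipschitzWith (54756 * Real.pi).toNNReal impermeableWave :=
  LipschitzWith.of_dist_le' abs_impermeableWave_sub_le

theorem eVariationOn_impermeableWave_le (a : ℝ) :
    eVariationOn impermeableWave (Icc a (a + 1 / 2998219536)) ≤ ENNReal.ofReal 0.000058 := by
  refine (lipschitzWith_impermeableWave.eVariationOn_Icc_le _ _).trans ?_
  rw [← ENNReal.ofReal, ← ENNReal.ofReal_mul (by positivity)]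
  apply ENNReal.ofReal_le_ofReal
  have := Real.pi_lt_d2
  rw [add_sub_cancel_left]
  linarith

theorem exists_impermeableWave_eq {i : ℕ} {v : ℝ} (hv : |v| < 2) :
    ∃ x ∈ Ico ((i : ℝ) / 27378) ((i + 1) / 27378), impermeableWave x = v := by
  have hi1 := impermeableWave_div (i + 1)
  push_cast at hi1
  have hv' := abs_lt.1 hv
  have hmem : v ∈ uIcc (impermeableWave ((i : ℝ) / 27378))
      (impermeableWave (((i : ℝ) + 1) / 27378)) := by
    rw [impermeableWave_div, hi1, pow_succ]
    rcases neg_one_pow_eq_or ℝ i with h | h <;> rw [h, mem_uIcc]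
    · right; constructor <;> linarith
    · left; constructor <;> linarith
  obtain ⟨x, hx, hxv⟩ := intermediate_value_uIcc continuous_impermeableWave.continuousOn hmem
  rw [uIcc_of_le (by gcongr; linarith)] at hx
  refine ⟨x, ⟨hx.1, lt_of_le_of_ne hx.2 ?_⟩, hxv⟩
  rintro rfl
  rw [hi1] at hxv
  rw [← hxv, abs_mul, abs_neg_one_pow, abs_two] at hv
  linarith

/-- A function of small variation starting near `0` is, after subtracting the wave and rescaling,
again of this kind on a subinterval avoiding a given point. -/
theorem exists_rescaled_eVariationOn_lt {f : ℝ → ℝ} (h0 : |f 0| ≤ 1)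
    (hf : eVariationOn f (Icc 0 1) < 1) (c : ℝ) :
    ∃ j : ℕ, j < 2998219536 ∧
      c ∉ Icc ((j : ℝ) / 2998219536) ((j + 1) / 2998219536) ∧
      |10000 * (f (j / 2998219536) - impermeableWave (j / 2998219536))| ≤ 1 ∧
      eVariationOn (fun y => 10000 * (f ((j + y) / 2998219536) -
        impermeableWave ((j + y) / 2998219536))) (Icc 0 1) < 1 := by
  obtain ⟨i, hiK, hci, hvar⟩ := exists_piece_eVariationOn_lt (K := 27378) (v := 0.000042)
    (by norm_num) hf (by norm_num) (by norm_num) c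
  push_cast at hci hvar
  have hi' : (i : ℝ) + 1 ≤ 27378 := by exact_mod_cast hiK
  have hi0 : (0 : ℝ) ≤ i := i.cast_nonneg
  have hv : |f (i / 27378)| < 2 := by
    have h1 := abs_sub_lt_of_eVariationOn_lt (v := 1) (by simpa using hf)
      (show (i : ℝ) / 27378 ∈ Icc (0 : ℝ) 1 from
        ⟨by positivity, by rw [div_le_one (by norm_num)]; linarith⟩)
      (show (0 : ℝ) ∈ Icc (0 : ℝ) 1 by simp)
    have h2 := abs_sub_abs_le_abs_sub (f (i / 27378)) (f 0)
    linarith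
  obtain ⟨x, hx, hxv⟩ := exists_impermeableWave_eq (i := i) hv
  have hx0 : 0 ≤ x := le_trans (by positivity) hx.1
  set j := ⌊2998219536 * x⌋₊ with hj
  have hjx : (j : ℝ) ≤ 2998219536 * x := Nat.floor_le (by positivity)
  have hjx' : 2998219536 * x < j + 1 := Nat.lt_floor_add_one _
  have hij : i * 109512 ≤ j := by
    apply Nat.le_floor
    push_cast
    linarith [hx.1]
  have hji : j < (i + 1) * 109512 := by
    rw [hj, Nat.floor_lt (by positivity)]
    push_cast
    linarith [hx.2]
  have hij' : (i : ℝ) * 109512 ≤ j := by exact_mod_cast hij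
  have hji' : (j : ℝ) + 1 ≤ (i + 1) * 109512 := by exact_mod_cast hji
  have hl : (i : ℝ) / 27378 ≤ j / 2998219536 := by linarith
  have hr : ((j : ℝ) + 1) / 2998219536 ≤ (i + 1) / 27378 := by linarith
  refine ⟨j, by omega, fun hc => hci ⟨hl.trans hc.1, hc.2.trans hr⟩, ?_, ?_⟩
  · have hmem : ((j : ℝ) / 2998219536) ∈ Icc ((i : ℝ) / 27378) ((i + 1) / 27378) :=
      ⟨hl, by linarith⟩
    have hmem0 : ((i : ℝ) / 27378) ∈ Icc ((i : ℝ) / 27378) ((i + 1) / 27378) :=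
      ⟨le_rfl, by linarith⟩
    have h1 := abs_sub_lt_of_eVariationOn_lt hvar hmem hmem0
    have h2 := abs_impermeableWave_sub_le x (j / 2998219536)
    have h3 : |x - j / 2998219536| ≤ 1 / 2998219536 := by
      rw [abs_of_nonneg] <;> linarith
    have h4 : 54756 * Real.pi * |x - j / 2998219536| ≤ 54756 * Real.pi * (1 / 2998219536) := by
      gcongr
    have h5 := Real.pi_lt_d2
    rw [hxv] at h2
    have h6 := abs_add_le (f (j / 2998219536) - f (i / 27378))
      (f (i / 27378) - impermeableWave (j / 2998219536))
    rw [sub_add_sub_cancel] at h6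
    rw [abs_mul, abs_of_pos (by norm_num : (0 : ℝ) < 10000)]
    linarith
  · set φ : ℝ → ℝ := fun y => (j + y) / 2998219536 with hφ
    have hmono : MonotoneOn φ (Icc 0 1) := fun y _ z _ hyz => by
      simp only [hφ]
      gcongr
    have hmaps : MapsTo φ (Icc 0 1)
        (Icc ((j : ℝ) / 2998219536) (j / 2998219536 + 1 / 2998219536)) := by
      intro y hy
      simp only [hφ]
      constructor <;> linarith [hy.1, hy.2]
    have hfv : eVariationOn (f ∘ φ) (Icc 0 1) < ENNReal.ofReal 0.000042 := by
      refine ((eVariationOn.comp_le_of_monotoneOn f φ hmono hmaps).trans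
        (eVariationOn.mono f ?_)).trans_lt hvar
      exact Icc_subset_Icc hl (by linarith)
    have hhv : eVariationOn (impermeableWave ∘ φ) (Icc 0 1) ≤ ENNReal.ofReal 0.000058 :=
      (eVariationOn.comp_le_of_monotoneOn _ φ hmono hmaps).trans
        (eVariationOn_impermeableWave_le _)
    refine (eVariationOn_const_mul_sub_le 10000 (f ∘ φ) (impermeableWave ∘ φ) _).trans_lt ?_
    have hsum := ENNReal.add_lt_add_of_lt_of_le (hhv.trans_lt ENNReal.ofReal_lt_top).ne hfv hhv
    rw [← ENNReal.ofReal_add (by norm_num) (by norm_num)] at hsum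
    refine (ENNReal.mul_lt_mul_right (by simp) ENNReal.ofReal_ne_top hsum).trans_eq ?_
    rw [← ENNReal.ofReal_mul (abs_nonneg _), abs_of_pos (by norm_num : (0 : ℝ) < 10000)]
    norm_num

/-- The difference between `f` and the `k`-th partial sum of the wave series, rescaled to the
`m`-th interval of generation `k`. -/
noncomputable def rescaledDifference (f : ℝ → ℝ) (k m : ℕ) (y : ℝ) : ℝ :=
  10000 ^ k * (f ((m + y) / 2998219536 ^ k) - ∑ n ∈ Finset.range k,
    impermeableWave (2998219536 ^ n * ((m + y) / 2998219536 ^ k)) / 10000 ^ n)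

theorem rescaledDifference_succ (f : ℝ → ℝ) (k m j : ℕ) (y : ℝ) :
    rescaledDifference f (k + 1) (2998219536 * m + j) y =
      10000 * (rescaledDifference f k m ((j + y) / 2998219536) -
        impermeableWave ((j + y) / 2998219536)) := by
  have hN : (2998219536 : ℝ) ^ k ≠ 0 := by positivity
  have hM : (10000 : ℝ) ^ k ≠ 0 := by positivity
  have e : (((2998219536 * m + j : ℕ) : ℝ) + y) / 2998219536 ^ (k + 1) =
      (m + (j + y) / 2998219536) / 2998219536 ^ k := by
    rw [pow_succ]
    push_cast
    field_simp
    ring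
  unfold rescaledDifference
  rw [e, Finset.sum_range_succ, mul_div_cancel₀ _ hN, impermeableWave_natCast_add, pow_succ]
  field_simp
  ring

/-- The `m`-th interval of generation `k` is one where `f` stays close to the partial sums. -/
def IsTrapping (f : ℝ → ℝ) (k m : ℕ) : Prop :=
  |rescaledDifference f k m 0| ≤ 1 ∧ eVariationOn (rescaledDifference f k m) (Icc 0 1) < 1

theorem IsTrapping.exists_succ {f : ℝ → ℝ} {k m : ℕ} (h : IsTrapping f k m) (c : ℝ) :
    ∃ m' : ℕ, IsTrapping f (k + 1) m' ∧
      Icc ((m' : ℝ) / 2998219536 ^ (k + 1)) ((m' + 1) / 2998219536 ^ (k + 1)) ⊆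
        Icc ((m : ℝ) / 2998219536 ^ k) ((m + 1) / 2998219536 ^ k) ∧
      c ∉ Icc ((m' : ℝ) / 2998219536 ^ (k + 1)) ((m' + 1) / 2998219536 ^ (k + 1)) := by
  obtain ⟨j, hj, hc, h1, h2⟩ := exists_rescaled_eVariationOn_lt h.1 h.2 (2998219536 ^ k * c - m)
  have hN : (0 : ℝ) < 2998219536 ^ k := by positivity
  refine ⟨2998219536 * m + j, ⟨?_, ?_⟩, ?_, ?_⟩
  · rw [rescaledDifference_succ, add_zero]
    exact h1
  · rw [show rescaledDifference f (k + 1) (2998219536 * m + j) = _ from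
      funext fun y => rescaledDifference_succ f k m j y]
    exact h2
  · have hj' : (j : ℝ) + 1 ≤ 2998219536 := by exact_mod_cast hj
    have hj0 : (0 : ℝ) ≤ j := j.cast_nonneg
    push_cast
    refine Icc_subset_Icc ?_ ?_ <;> rw [pow_succ, div_le_div_iff₀ (by positivity) (by positivity)]
    · nlinarith
    · nlinarith
  · intro hmem
    apply hc
    push_cast at hmem
    rw [mem_Icc, pow_succ, div_le_iff₀ (by positivity), le_div_iff₀ (by positivity)] at hmem
    rw [mem_Icc, div_le_iff₀ (by norm_num), le_div_iff₀ (by norm_num)]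
    constructor <;> nlinarith [hmem.1, hmem.2]

theorem IsTrapping.abs_sub_le {f : ℝ → ℝ} {k m : ℕ} (h : IsTrapping f k m) {t : ℝ}
    (ht : t ∈ Icc ((m : ℝ) / 2998219536 ^ k) ((m + 1) / 2998219536 ^ k)) :
    |f t - ∑ n ∈ Finset.range k, impermeableWave (2998219536 ^ n * t) / 10000 ^ n| ≤
      2 * (1 / 10000) ^ k := by
  have hN : (0 : ℝ) < 2998219536 ^ k := by positivity
  rw [mem_Icc, div_le_iff₀ hN, le_div_iff₀ hN] at ht
  have h1 := abs_sub_lt_of_eVariationOn_lt (v := 1) (by simpa using h.2)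
    (show t * 2998219536 ^ k - m ∈ Icc (0 : ℝ) 1 from ⟨by linarith [ht.1], by linarith [ht.2]⟩)
    (show (0 : ℝ) ∈ Icc (0 : ℝ) 1 by simp)
  have h2 := abs_sub_abs_le_abs_sub (rescaledDifference f k m (t * 2998219536 ^ k - m))
    (rescaledDifference f k m 0)
  have h3 : |rescaledDifference f k m (t * 2998219536 ^ k - m)| ≤ 2 := by
    linarith [h.1]
  unfold rescaledDifference at h3
  rw [add_sub_cancel, mul_div_cancel_right₀ _ hN.ne', abs_mul,
    abs_of_pos (by positivity : (0 : ℝ) < 10000 ^ k)] at h3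
  rw [one_div, inv_pow, ← div_eq_mul_inv, le_div_iff₀' (by positivity)]
  exact h3

theorem exists_eq_weierstrassSeries_avoiding {f : ℝ → ℝ} (h0 : f 0 = 0)
    (hf : eVariationOn f (Icc 0 1) < 1) (c : ℕ → ℝ) :
    ∃ t ∈ Icc (0 : ℝ) 1, weierstrassSeries impermeableWave 10000 2998219536 t = f t ∧
      ∀ n, t ≠ c n := by
  have hstart : IsTrapping f 0 0 := by
    have : rescaledDifference f 0 0 = f := by
      funext y
      simp [rescaledDifference]
    rw [IsTrapping, this, h0]
    simpa using hf
  choose next hnext using fun k (s : {m : ℕ // IsTrapping f k m}) => s.2.exists_succ (c k)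
  let seq : ∀ k, {m : ℕ // IsTrapping f k m} := fun k =>
    Nat.rec ⟨0, hstart⟩ (fun k s => ⟨next k s, (hnext k s).1⟩) k
  have hanti : Antitone fun k : ℕ => Icc (((seq k).1 : ℝ) / 2998219536 ^ k)
      (((seq k).1 + 1) / 2998219536 ^ k) :=
    antitone_nat_of_succ_le fun k => (hnext k (seq k)).2.1
  have ht := ciSup_mem_iInter_Icc_of_antitone_Icc hanti
    (fun k => by gcongr; linarith)
  set t := ⨆ k : ℕ, ((seq k).1 : ℝ) / 2998219536 ^ k
  rw [mem_iInter] at ht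
  refine ⟨t, by simpa [seq] using ht 0, ?_, fun n hn => ?_⟩
  · have hS := (summable_weierstrassSeries (N := 2998219536) (M := 10000) (by norm_num)
      abs_impermeableWave_le t).hasSum.tendsto_sum_nat
    refine tendsto_nhds_unique hS ?_
    rw [tendsto_iff_norm_sub_tendsto_zero]
    have hgeom := (tendsto_pow_atTop_nhds_zero_of_lt_one (r := (1 / 10000 : ℝ))
      (by norm_num) (by norm_num)).const_mul 2
    rw [mul_zero] at hgeom
    refine squeeze_zero (fun _ => norm_nonneg _) (fun k => ?_) hgeom
    rw [Real.norm_eq_abs, abs_sub_comm]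
    exact (seq k).2.abs_sub_le (ht k)
  · exact (hnext n (seq n)).2.2 (hn ▸ ht (n + 1))

end Construction

/-- There is a Hölder continuous function `g : [0,1] → ℝ` with Hölder
exponent `log 10 / log 234` such that for every `f` with `f 0 = 0` and total variation
`< 1`, the set `{t ∈ [0,1] : g t = f t}` is uncountable. -/
theorem exists_holder_impermeable_graph :
    ∃ g : ℝ → ℝ,
      (∃ C : ℝ, 0 < C ∧ ∀ x ∈ Set.Icc (0:ℝ) 1, ∀ y ∈ Set.Icc (0:ℝ) 1,
        |g x - g y| ≤ C * |x - y| ^ (Real.log 10 / Real.log 234)) ∧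
      ∀ f : ℝ → ℝ, f 0 = 0 → eVariationOn f (Set.Icc 0 1) < 1 →
        ¬ ({t ∈ Set.Icc (0:ℝ) 1 | g t = f t}).Countable := by
  refine ⟨weierstrassSeries impermeableWave 10000 2998219536,
    ⟨4 * 2 + 54756 * Real.pi * 2998219536, by positivity, fun x hx y hy => ?_⟩,
    fun f h0 hf hcount => ?_⟩
  · refine weierstrassSeries_holder (by norm_num) (by norm_num) abs_impermeableWave_le
      abs_impermeableWave_sub_le (div_pos (Real.log_pos (by norm_num)) (Real.log_pos (by norm_num)))
      ?_ x y (abs_sub_le_iff.2 ⟨by linarith [hx.2, hy.1], by linarith [hx.1, hy.2]⟩)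
    have h234 : (234 : ℝ) ^ (Real.log 10 / Real.log 234) = 10 := by
      rw [Real.rpow_def_of_pos (by norm_num),
        mul_div_cancel₀ _ (Real.log_pos (by norm_num)).ne', Real.exp_log (by norm_num)]
    rw [show (2998219536 : ℝ) = 234 ^ 4 by norm_num, ← Real.rpow_natCast, ← Real.rpow_mul
      (by norm_num), mul_comm, Real.rpow_mul (by norm_num), h234]
    norm_num
  · obtain ⟨c, hc⟩ := Set.countable_iff_exists_subset_range.1 hcount
    obtain ⟨t, ht, hgt, hne⟩ := exists_eq_weierstrassSeries_avoiding h0 hf c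
    obtain ⟨n, hn⟩ := hc ⟨ht, hgt⟩
    exact hne n hn.symm
end

section
/- There exists a continuous function g : [0,1] → ℝ such that for every function f : [0,1] → ℝ with f(0) = 0 and total variation V_0^1(f) < 1, the set {t ∈ [0,1] : f(t) = g(t)} has Hausdorff dimension equal to 1. -/
open Set
open scoped ENNReal


/-- If `ψ : [0,1) → E` satisfies `|u - v| ≤ C |ψ u - ψ v| ^ s`, then `E` has dimension at
least `s`. -/
theorem le_dimH_of_dist_le_rpow {E : Set ℝ} {ψ : ℝ → ℝ} {C s : NNReal} (hs : 0 < s)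
    (hψ : ∀ u ∈ Ico (0 : ℝ) 1, ψ u ∈ E)
    (h : ∀ u ∈ Ico (0 : ℝ) 1, ∀ v ∈ Ico (0 : ℝ) 1,
      dist u v ≤ C * dist (ψ u) (ψ v) ^ (s : ℝ)) :
    (s : ℝ≥0∞) ≤ dimH E := by
  have hinj : InjOn ψ (Ico (0 : ℝ) 1) := by
    intro u hu v hv huv
    have := h u hu v hv
    rw [huv, dist_self, Real.zero_rpow (by positivity), mul_zero] at this
    exact dist_le_zero.1 this
  have hleft : LeftInvOn (Function.invFunOn ψ (Ico (0 : ℝ) 1)) ψ (Ico (0 : ℝ) 1) :=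
    hinj.leftInvOn_invFunOn
  have hH : HolderOnWith C s (Function.invFunOn ψ (Ico (0 : ℝ) 1)) (ψ '' Ico (0 : ℝ) 1) := by
    rintro _ ⟨u, hu, rfl⟩ _ ⟨v, hv, rfl⟩
    rw [hleft hu, hleft hv, edist_dist, edist_dist,
      ENNReal.ofReal_rpow_of_nonneg dist_nonneg s.coe_nonneg, ← ENNReal.ofReal_coe_nnreal,
      ← ENNReal.ofReal_mul C.coe_nonneg]
    exact ENNReal.ofReal_le_ofReal (h u hu v hv)
  have h1 := hH.dimH_image_le hs
  rw [hleft.image_image, Real.dimH_of_nonempty_interior (by simp [interior_Ico]),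
    Module.finrank_self, Nat.cast_one, ENNReal.le_div_iff_mul_le (by simp [hs.ne']) (by simp),
    one_mul] at h1
  exact h1.trans (dimH_mono (image_subset_iff.2 hψ))

/-- A lower bound for the dimension of a set containing all limit points of a tree of nested
intervals. The intervals of generation `k` have length `ℓ k` and left endpoints satisfying `P k`,
and each of them has `D k` well-separated children. -/
theorem le_dimH_of_tree {E : Set ℝ} {D : ℕ → ℕ} {ℓ : ℕ → ℝ} {P : ℕ → ℝ → Prop} {a₀ : ℝ}
    {C s : NNReal} (hD : ∀ k, 2 ≤ D k) (hℓ : ∀ k, 0 < ℓ k) (h0 : P 0 a₀)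
    (hstep : ∀ k a, P k a → ∃ c : ℕ → ℝ,
      (∀ i < D k, P (k + 1) (c i) ∧ a ≤ c i ∧ c i + ℓ (k + 1) ≤ a + ℓ k) ∧
      ∀ i j, i < j → j < D k →
        c i + ℓ (k + 1) + ((j : ℝ) - i) * (ℓ k / (4 * D k)) ≤ c j)
    (hE : ∀ (a : ℕ → ℝ) (x : ℝ), (∀ k, P k (a k) ∧ x ∈ Icc (a k) (a k + ℓ k)) → x ∈ E)
    (hs : 0 < s) (hs1 : s ≤ 1)
    (hC : ∀ k, 1 ≤ C * ((∏ j ∈ Finset.range k, (D j : ℝ)) * ℓ k ^ (s : ℝ))) :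
    (s : ℝ≥0∞) ≤ dimH E := by
  choose! c hc hsep using hstep
  let st : ℝ → ℕ → ℝ × ℝ := fun u k => Nat.rec (a₀, u)
    (fun k p => (c k p.1 ⌊D k * p.2⌋₊, Int.fract (D k * p.2))) k
  have st0 : ∀ u, st u 0 = (a₀, u) := fun _ => rfl
  have stS : ∀ u k, st u (k + 1) =
    (c k (st u k).1 ⌊D k * (st u k).2⌋₊, Int.fract (D k * (st u k).2)) := fun _ _ => rfl
  clear_value st
  have hDpos : ∀ k, (0 : ℝ) < D k := fun k => by
    have := hD k
    exact_mod_cast (by omega : 0 < D k)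
  have hmem : ∀ u ∈ Ico (0 : ℝ) 1, ∀ k, (st u k).2 ∈ Ico (0 : ℝ) 1 := by
    intro u hu k
    cases k with
    | zero => simpa [st0] using hu
    | succ k => rw [stS]; exact ⟨Int.fract_nonneg _, Int.fract_lt_one _⟩
  have hdig : ∀ u ∈ Ico (0 : ℝ) 1, ∀ k, ⌊D k * (st u k).2⌋₊ < D k := by
    intro u hu k
    have h := hmem u hu k
    rw [Nat.floor_lt (mul_nonneg (hDpos k).le h.1)]
    nlinarith [hDpos k, h.2]
  have hP : ∀ u ∈ Ico (0 : ℝ) 1, ∀ k, P k (st u k).1 := by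
    intro u hu k
    induction k with
    | zero => simpa [st0] using h0
    | succ k ih => rw [stS]; exact (hc k _ ih _ (hdig u hu k)).1
  let ψ : ℝ → ℝ := fun u => ⨆ k, (st u k).1
  have hψ : ∀ u ∈ Ico (0 : ℝ) 1, ∀ k, ψ u ∈ Icc (st u k).1 ((st u k).1 + ℓ k) := by
    intro u hu k
    refine mem_iInter.1 (ciSup_mem_iInter_Icc_of_antitone_Icc
      (f := fun k => (st u k).1) (g := fun k => (st u k).1 + ℓ k)
      (antitone_nat_of_succ_le fun k => ?_) fun k => by linarith [hℓ k]) k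
    have h := (hc k _ (hP u hu k) _ (hdig u hu k)).2
    rw [stS]
    exact Icc_subset_Icc h.1 h.2
  have hQ : ∀ k, (2 : ℝ) ^ k ≤ ∏ j ∈ Finset.range k, (D j : ℝ) := by
    intro k
    calc (2 : ℝ) ^ k = ∏ j ∈ Finset.range k, (2 : ℝ) := by simp
      _ ≤ _ := Finset.prod_le_prod (by simp) fun j _ => by exact_mod_cast hD j
  have hagree : ∀ u v n, (∀ k < n, ⌊D k * (st u k).2⌋₊ = ⌊D k * (st v k).2⌋₊) →
      u ∈ Ico (0 : ℝ) 1 → v ∈ Ico (0 : ℝ) 1 →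
      (st u n).1 = (st v n).1 ∧
        (st v n).2 - (st u n).2 = (∏ j ∈ Finset.range n, (D j : ℝ)) * (v - u) := by
    intro u v n h hu hv
    induction n with
    | zero => simp [st0]
    | succ n ih =>
      obtain ⟨h1, h2⟩ := ih fun k hk => h k (by omega)
      have h3 := h n (by omega)
      have h4 : (⌊D n * (st u n).2⌋ : ℝ) = ⌊D n * (st v n).2⌋ := by
        rw [← natCast_floor_eq_intCast_floor (mul_nonneg (hDpos n).le (hmem u hu n).1), h3,
          natCast_floor_eq_intCast_floor (mul_nonneg (hDpos n).le (hmem v hv n).1)]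
      refine ⟨by rw [stS, stS, h1, h3], ?_⟩
      rw [stS, stS, Finset.prod_range_succ]
      simp only [Int.fract]
      rw [h4]
      linear_combination (D n : ℝ) * h2
  have key : ∀ u ∈ Ico (0 : ℝ) 1, ∀ v ∈ Ico (0 : ℝ) 1, u < v →
      dist u v ≤ (8 * C : NNReal) * dist (ψ u) (ψ v) ^ (s : ℝ) := by
    intro u hu v hv huv
    have hex : ∃ k, ⌊D k * (st u k).2⌋₊ ≠ ⌊D k * (st v k).2⌋₊ := by
      by_contra! hcon
      obtain ⟨n, hn⟩ := pow_unbounded_of_one_lt (1 / (v - u)) (one_lt_two : (1 : ℝ) < 2)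
      have h1 := (hagree u v n (fun k _ => hcon k) hu hv).2
      rw [div_lt_iff₀ (by linarith)] at hn
      have h2 := mul_le_mul_of_nonneg_right (hQ n) (by linarith : 0 ≤ v - u)
      linarith [(hmem u hu n).1, (hmem v hv n).2]
    classical
    obtain ⟨k, hk, hmin⟩ : ∃ k, ⌊D k * (st u k).2⌋₊ ≠ ⌊D k * (st v k).2⌋₊ ∧
        ∀ m < k, ⌊D m * (st u m).2⌋₊ = ⌊D m * (st v m).2⌋₊ :=
      ⟨Nat.find hex, Nat.find_spec hex, fun m hm => not_not.1 (Nat.find_min hex hm)⟩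
    obtain ⟨ha, hd⟩ := hagree u v k hmin hu hv
    have hψu := (hψ u hu (k + 1)).2
    have hψv := (hψ v hv (k + 1)).1
    rw [stS] at hψu hψv
    have hju := hdig v hv k
    set Q := ∏ j ∈ Finset.range k, (D j : ℝ) with hQdef
    have hQpos : 0 < Q := lt_of_lt_of_le (by positivity) (hQ k)
    have hlt : (st u k).2 < (st v k).2 := by nlinarith [mul_pos hQpos (sub_pos.2 huv)]
    have hle : ⌊D k * (st u k).2⌋₊ ≤ ⌊D k * (st v k).2⌋₊ :=
      Nat.floor_mono (mul_le_mul_of_nonneg_left hlt.le (hDpos k).le)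
    have hfu := Nat.floor_le (mul_nonneg (hDpos k).le (hmem u hu k).1)
    have hfv := Nat.lt_floor_add_one (D k * (st v k).2)
    have hs' := hsep k _ (hP u hu k) _ _ (lt_of_le_of_ne hle hk) hju
    rw [← ha] at hψv
    set i := ⌊D k * (st u k).2⌋₊
    set j := ⌊D k * (st v k).2⌋₊
    have hij : (i : ℝ) + 1 ≤ j := by exact_mod_cast lt_of_le_of_ne hle hk
    have hjD : (j : ℝ) ≤ D k := by exact_mod_cast hju.le
    have hi0 : (0 : ℝ) ≤ i := by positivity
    have hDk := hDpos k
    have hlk := hℓ k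
    set d : ℝ := ((j : ℝ) - i) / D k with hddef
    have hd0 : 0 < d := div_pos (by linarith) hDk
    have hd1 : d ≤ 1 := by rw [hddef, div_le_one hDk]; linarith
    have hdist : d * (ℓ k / 4) ≤ dist (ψ u) (ψ v) := by
      have : ((j : ℝ) - i) * (ℓ k / (4 * D k)) = d * (ℓ k / 4) := by
        rw [hddef]; field_simp
      rw [this] at hs'
      rw [dist_comm, Real.dist_eq]
      refine le_trans ?_ (le_abs_self _)
      simp only at hψu hψv
      linarith
    have huv' : Q * (v - u) ≤ 2 * d := by
      have : D k * (Q * (v - u)) ≤ D k * (2 * d) := by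
        rw [← hd, hddef]
        have : (D k : ℝ) * (2 * (((j : ℝ) - i) / D k)) = 2 * ((j : ℝ) - i) := by field_simp
        rw [this]
        linarith
      exact le_of_mul_le_mul_left this hDk
    have hrp : d * ℓ k ^ (s : ℝ) ≤ 4 * dist (ψ u) (ψ v) ^ (s : ℝ) := by
      have h1 : d ≤ d ^ (s : ℝ) := by
        simpa using Real.rpow_le_rpow_of_exponent_ge hd0 hd1 (by exact_mod_cast hs1 : (s : ℝ) ≤ 1)
      have h2 : (4 : ℝ) ^ (s : ℝ) ≤ 4 := by
        simpa using Real.rpow_le_rpow_of_exponent_le (by norm_num : (1 : ℝ) ≤ 4)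
          (by exact_mod_cast hs1 : (s : ℝ) ≤ 1)
      calc d * ℓ k ^ (s : ℝ) ≤ d ^ (s : ℝ) * ℓ k ^ (s : ℝ) := by gcongr
        _ = (4 * (d * (ℓ k / 4))) ^ (s : ℝ) := by
          rw [← Real.mul_rpow hd0.le hlk.le]; congr 1; ring
        _ = 4 ^ (s : ℝ) * (d * (ℓ k / 4)) ^ (s : ℝ) :=
          Real.mul_rpow (by norm_num) (by positivity)
        _ ≤ 4 * dist (ψ u) (ψ v) ^ (s : ℝ) := by gcongr
    have hCk := hC k
    rw [← hQdef] at hCk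
    rw [dist_comm u v, Real.dist_eq, abs_of_pos (sub_pos.2 huv)]
    push_cast
    calc v - u ≤ (C * (Q * ℓ k ^ (s : ℝ))) * (v - u) :=
          le_mul_of_one_le_left (by linarith) hCk
      _ = C * ℓ k ^ (s : ℝ) * (Q * (v - u)) := by ring
      _ ≤ C * ℓ k ^ (s : ℝ) * (2 * d) := by gcongr
      _ = 2 * C * (d * ℓ k ^ (s : ℝ)) := by ring
      _ ≤ 2 * C * (4 * dist (ψ u) (ψ v) ^ (s : ℝ)) := by gcongr
      _ = 8 * C * dist (ψ u) (ψ v) ^ (s : ℝ) := by ring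
  refine le_dimH_of_dist_le_rpow (ψ := ψ) (C := 8 * C) hs
    (fun u hu => hE _ _ fun k => ⟨hP u hu k, hψ u hu k⟩) fun u hu v hv => ?_
  rcases lt_trichotomy u v with h | h | h
  · exact key u hu v hv h
  · subst h
    simp only [dist_self]
    positivity
  · rw [dist_comm u v, dist_comm (ψ u)]
    exact key v hv u hu h


/-- Length of the intervals of generation `k`. -/
noncomputable def treeLength : ℕ → ℝ
  | 0 => 1
  | k + 1 => treeLength k / 2 ^ (k + 11)

/-- Frequency of the `k`-th sine wave. -/
noncomputable def waveFreq (k : ℕ) : ℝ := 4 * Real.pi * 2 ^ (k + 3) / treeLength k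

/-- Partial sums of the series defining the oscillating function. -/
noncomputable def waveSum (n : ℕ) (t : ℝ) : ℝ :=
  ∑ k ∈ Finset.range n, 2 / 2 ^ k * Real.sin (waveFreq k * t)

theorem treeLength_pos (k : ℕ) : 0 < treeLength k := by
  induction k with
  | zero => simp [treeLength]
  | succ k ih => rw [treeLength]; positivity

theorem waveFreq_pos (k : ℕ) : 0 < waveFreq k := by
  have := treeLength_pos k
  have := Real.pi_pos
  unfold waveFreq
  positivity

theorem abs_sin_mul_sub_sin_mul_le {w : ℝ} (hw : 0 ≤ w) (x y : ℝ) :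
    |Real.sin (w * x) - Real.sin (w * y)| ≤ w * |x - y| := by
  refine (Real.abs_sin_sub_sin_le _ _).trans_eq ?_
  rw [← mul_sub, abs_mul, abs_of_nonneg hw]

theorem waveSum_succ (n : ℕ) (t : ℝ) :
    waveSum (n + 1) t = waveSum n t + 2 / 2 ^ n * Real.sin (waveFreq n * t) :=
  Finset.sum_range_succ _ _

theorem abs_waveSum_sub_le (n : ℕ) (x y : ℝ) :
    |waveSum n x - waveSum n y| ≤ |x - y| / treeLength n := by
  induction n with
  | zero => simp [waveSum, treeLength]
  | succ n ih =>
    have hl := treeLength_pos n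
    have hs := abs_sin_mul_sub_sin_mul_le (waveFreq_pos n).le x y
    have hdecomp : waveSum (n + 1) x - waveSum (n + 1) y = (waveSum n x - waveSum n y) +
        2 / 2 ^ n * (Real.sin (waveFreq n * x) - Real.sin (waveFreq n * y)) := by
      rw [waveSum_succ, waveSum_succ]; ring
    have h2 : (2 : ℝ) / 2 ^ n * (waveFreq n * |x - y|) =
        64 * Real.pi * (|x - y| / treeLength n) := by
      unfold waveFreq
      field_simp
      ring
    have h3 : |x - y| / treeLength (n + 1) = 2 ^ n * 2048 * (|x - y| / treeLength n) := by
      rw [treeLength]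
      field_simp
      ring
    have h4 : (0 : ℝ) ≤ |x - y| / treeLength n := by positivity
    have h5 : (1 : ℝ) ≤ 2 ^ n := one_le_pow₀ (by norm_num)
    calc |waveSum (n + 1) x - waveSum (n + 1) y|
        ≤ |waveSum n x - waveSum n y| +
          2 / 2 ^ n * |Real.sin (waveFreq n * x) - Real.sin (waveFreq n * y)| := by
          rw [hdecomp]
          refine (abs_add_le _ _).trans_eq ?_
          rw [abs_mul, abs_of_pos (by positivity : (0 : ℝ) < 2 / 2 ^ n)]
      _ ≤ |x - y| / treeLength n + 2 / 2 ^ n * (waveFreq n * |x - y|) := by gcongr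
      _ ≤ |x - y| / treeLength (n + 1) := by
          rw [h2, h3]
          nlinarith [Real.pi_lt_four, mul_nonneg h4 (sub_nonneg.2 h5)]

theorem exists_sin_mul_eq {w y b : ℝ} (hw : 0 < w) (h1 : -1 ≤ y) (h2 : y ≤ 1) :
    ∃ t ∈ Ico b (b + 2 * Real.pi / w), Real.sin (w * t) = y := by
  obtain ⟨m, hm, -⟩ := existsUnique_add_zsmul_mem_Ico Real.two_pi_pos (Real.arcsin y) (w * b)
  refine ⟨(Real.arcsin y + m • (2 * Real.pi)) / w, ⟨?_, ?_⟩, ?_⟩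
  · rw [le_div_iff₀ hw, mul_comm]
    exact hm.1
  · rw [div_lt_iff₀ hw, add_mul, div_mul_cancel₀ _ hw.ne', mul_comm b]
    exact hm.2
  · rw [mul_div_cancel₀ _ hw.ne', zsmul_eq_mul, Real.sin_add_int_mul_two_pi,
      Real.sin_arcsin h1 h2]

theorem abs_sub_le_of_eVariationOn_le {f : ℝ → ℝ} {s : Set ℝ} {x y r : ℝ} (hr : 0 ≤ r)
    (h : eVariationOn f s ≤ ENNReal.ofReal r) (hx : x ∈ s) (hy : y ∈ s) : |f x - f y| ≤ r := by
  have := (eVariationOn.edist_le f hx hy).trans h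
  rwa [edist_dist, ENNReal.ofReal_le_ofReal_iff hr, Real.dist_eq] at this

/-- On a block where `f` varies little, one more wave brings the approximation close to `f` on an
interval of the next generation, contained in the first half of the block. -/
theorem exists_child_of_eVariationOn_le {f : ℝ → ℝ} {k : ℕ} {b W : ℝ}
    (hW : W = treeLength k / 2 ^ (k + 3))
    (hf : eVariationOn f (Icc b (b + W)) ≤ ENNReal.ofReal (1 / 2 ^ (k + 2)))
    (hb : |f b - waveSum k b| ≤ 1 / 2 ^ k) :
    ∃ c, b ≤ c ∧ c + treeLength (k + 1) ≤ b + W / 2 ∧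
      ∀ t ∈ Icc c (c + treeLength (k + 1)), |f t - waveSum (k + 1) t| ≤ 1 / 2 ^ (k + 1) := by
  have hl := treeLength_pos k
  have hl' := treeLength_pos (k + 1)
  have hWpos : 0 < W := by rw [hW]; positivity
  have hlW : treeLength (k + 1) = W / 256 := by
    rw [treeLength, hW]; field_simp; ring
  have hwW : waveFreq k = 4 * Real.pi / W := by
    rw [waveFreq, hW]; field_simp
  have hpi := Real.pi_pos
  set x : ℝ := 1 / 2 ^ k with hx
  have hx0 : 0 < x := by positivity
  have hx1 : (2 : ℝ) / 2 ^ k = 2 * x := by rw [hx]; ring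
  have hx2 : (1 : ℝ) / 2 ^ (k + 2) = x / 4 := by rw [hx]; field_simp; ring
  have hx3 : (1 : ℝ) / 2 ^ (k + 1) = x / 2 := by rw [hx]; field_simp; ring
  rw [hx2] at hf
  rw [abs_le] at hb
  obtain ⟨t₁, ⟨ht1, ht2⟩, hsin⟩ := exists_sin_mul_eq (b := b) (waveFreq_pos k)
    (y := (f b - waveSum k b) / (2 * x))
    (by rw [le_div_iff₀ (by positivity)]; linarith) (by rw [div_le_iff₀ (by positivity)]; linarith)
  have hper : 2 * Real.pi / waveFreq k = W / 2 := by rw [hwW]; field_simp; norm_num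
  rw [hper] at ht2
  rw [eq_div_iff (by positivity)] at hsin
  have hc1 : min t₁ (b + W / 2 - treeLength (k + 1)) ≤ t₁ := min_le_left _ _
  have hc2 : min t₁ (b + W / 2 - treeLength (k + 1)) ≤ b + W / 2 - treeLength (k + 1) :=
    min_le_right _ _
  have hc3 : b ≤ min t₁ (b + W / 2 - treeLength (k + 1)) := le_min ht1 (by linarith)
  have hc4 : t₁ ≤ min t₁ (b + W / 2 - treeLength (k + 1)) + treeLength (k + 1) := by
    rcases min_choice t₁ (b + W / 2 - treeLength (k + 1)) with h | h <;> rw [h] <;> linarith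
  refine ⟨min t₁ (b + W / 2 - treeLength (k + 1)), hc3, by linarith, fun t ht => ?_⟩
  have e1 : |f t - f b| ≤ x / 4 := abs_sub_le_of_eVariationOn_le (by positivity) hf
    ⟨by linarith [ht.1], by linarith [ht.2]⟩ ⟨le_rfl, by linarith⟩
  have e2 : |waveSum k t - waveSum k b| ≤ x / 8 := by
    refine (abs_waveSum_sub_le k t b).trans ?_
    have : |t - b| ≤ W := by rw [abs_le]; constructor <;> linarith [ht.1, ht.2]
    calc |t - b| / treeLength k ≤ W / treeLength k := by gcongr
      _ = x / 8 := by rw [hW, hx]; field_simp; ring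
  have e3 : |2 * x * (Real.sin (waveFreq k * t) - Real.sin (waveFreq k * t₁))| ≤ x / 8 := by
    rw [abs_mul, abs_of_pos (by positivity : 0 < 2 * x)]
    have h1 := abs_sin_mul_sub_sin_mul_le (waveFreq_pos k).le t t₁
    have h2 : |t - t₁| ≤ W / 256 := by
      rw [← hlW, abs_le]; constructor <;> linarith [ht.1, ht.2]
    calc 2 * x * |Real.sin (waveFreq k * t) - Real.sin (waveFreq k * t₁)|
        ≤ 2 * x * (waveFreq k * (W / 256)) := by
          have := waveFreq_pos k
          gcongr
          exact h1.trans (by gcongr)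
      _ = x * (Real.pi / 32) := by rw [hwW]; field_simp; ring
      _ ≤ x / 8 := by nlinarith [Real.pi_lt_four]
  rw [hx3, waveSum_succ, hx1]
  rw [abs_le] at e1 e2 e3 ⊢
  constructor <;> nlinarith [hsin]

/-- Among `2 * n` consecutive blocks, at least `n` carry at most the fraction `1 / n` of a total
variation less than one. -/
theorem exists_strictMono_eVariationOn_le {f : ℝ → ℝ} {a W : ℝ} {n : ℕ} (hn : 0 < n)
    (hW : 0 ≤ W) (ha : eVariationOn f (Icc a (a + (2 * n : ℕ) * W)) < 1) :
    ∃ σ : ℕ → ℕ, (∀ i < n, σ i < 2 * n ∧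
      eVariationOn f (Icc (a + σ i * W) (a + σ i * W + W)) ≤ ENNReal.ofReal (1 / n)) ∧
      ∀ i j, i < j → j < n → σ i + (j - i) ≤ σ j := by
  classical
  have hn' : (0 : ℝ) < n := by exact_mod_cast hn
  set v : ℕ → ℝ≥0∞ := fun i => eVariationOn f (Icc (a + i * W) (a + i * W + W)) with hv
  set r := ENNReal.ofReal (1 / n) with hr
  have hr' : r = (n : ℝ≥0∞)⁻¹ := by
    rw [hr, one_div, ENNReal.ofReal_inv_of_pos hn', ENNReal.ofReal_natCast]
  have hsum : ∑ i ∈ Finset.range (2 * n), v i < 1 := by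
    have := eVariationOn.sum' f (I := fun i : ℕ => a + i * W) (n := 2 * n) (fun i j hij => by
      have : (i : ℝ) ≤ j := by exact_mod_cast hij
      simp only
      gcongr)
    simp only [Nat.cast_zero, zero_mul, add_zero] at this
    rw [← this] at ha
    refine lt_of_eq_of_lt (Finset.sum_congr rfl fun i _ => ?_) ha
    rw [hv]
    simp only
    congr 2
    push_cast
    ring
  set bad := (Finset.range (2 * n)).filter fun i => ¬ v i ≤ r with hbad
  set good := (Finset.range (2 * n)).filter fun i => v i ≤ r with hgood
  have hcard : good.card + bad.card = 2 * n := by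
    rw [hgood, hbad, Finset.card_filter_add_card_filter_not, Finset.card_range]
  have hbadn : bad.card < n := by
    have h1 : bad.card * r ≤ ∑ i ∈ Finset.range (2 * n), v i := by
      rw [← nsmul_eq_mul]
      refine (Finset.card_nsmul_le_sum bad v r fun i hi => ?_).trans
        (Finset.sum_le_sum_of_subset (Finset.filter_subset _ _))
      exact (not_le.1 (Finset.mem_filter.1 hi).2).le
    have h2 := h1.trans_lt hsum
    rw [hr', ← div_eq_mul_inv, ENNReal.div_lt_iff (by simp [hn.ne']) (by simp), one_mul] at h2
    exact_mod_cast h2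
  have hgoodn : n ≤ good.card := by omega
  set e := good.orderEmbOfCardLe hgoodn
  have hadd : ∀ i j (hi : i < n) (hj : j < n), i < j → e ⟨i, hi⟩ + (j - i) ≤ e ⟨j, hj⟩ := by
    intro i j hi hj hij
    induction j with
    | zero => omega
    | succ j ih =>
      have hlt : e ⟨j, by omega⟩ < e ⟨j + 1, hj⟩ := e.strictMono (by simp)
      rcases Nat.lt_succ_iff_lt_or_eq.1 hij with h | h
      · have := ih (by omega) h
        omega
      · subst h
        omega
  refine ⟨fun i => if h : i < n then e ⟨i, h⟩ else 0, fun i hi => ?_, fun i j hij hj => ?_⟩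
  · have := Finset.mem_filter.1 (good.orderEmbOfCardLe_mem hgoodn ⟨i, hi⟩)
    rw [Finset.mem_range] at this
    simpa [hi] using this
  · have hi : i < n := by omega
    simpa [hi, hj] using hadd i j hi hj hij

/-- An interval of generation `k` on which `f` is close to the `k`-th partial sum has
`2 ^ (k + 2)` well-separated children of the same kind. -/
theorem exists_children {f : ℝ → ℝ} (hf : eVariationOn f (Icc 0 1) < 1) {k : ℕ} {a : ℝ}
    (ha0 : 0 ≤ a) (ha1 : a + treeLength k ≤ 1)
    (ha : ∀ t ∈ Icc a (a + treeLength k), |f t - waveSum k t| ≤ 1 / 2 ^ k) :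
    ∃ c : ℕ → ℝ, (∀ i < 2 ^ (k + 2),
      (∀ t ∈ Icc (c i) (c i + treeLength (k + 1)),
        |f t - waveSum (k + 1) t| ≤ 1 / 2 ^ (k + 1)) ∧
      a ≤ c i ∧ c i + treeLength (k + 1) ≤ a + treeLength k) ∧
      ∀ i j, i < j → j < 2 ^ (k + 2) →
        c i + treeLength (k + 1) + ((j : ℝ) - i) * (treeLength k / (4 * (2 ^ (k + 2) : ℕ))) ≤
          c j := by
  have hl := treeLength_pos k
  obtain ⟨W, hW⟩ : ∃ W, W = treeLength k / 2 ^ (k + 3) := ⟨_, rfl⟩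
  have hW0 : 0 < W := by rw [hW]; positivity
  have hnW : ((2 * 2 ^ (k + 2) : ℕ) : ℝ) * W = treeLength k := by
    rw [hW]; push_cast; field_simp; ring
  obtain ⟨σ, hσ, hσadd⟩ := exists_strictMono_eVariationOn_le (f := f) (a := a) (W := W)
    (n := 2 ^ (k + 2)) (by positivity) hW0.le (by
      rw [hnW]
      exact (eVariationOn.mono f (Icc_subset_Icc ha0 ha1)).trans_lt hf)
  have hblock : ∀ i < 2 ^ (k + 2), a ≤ a + σ i * W ∧ a + σ i * W + W ≤ a + treeLength k := by
    intro i hi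
    have h1 : (σ i : ℝ) + 1 ≤ (2 * 2 ^ (k + 2) : ℕ) := by exact_mod_cast (hσ i hi).1
    have h2 := mul_le_mul_of_nonneg_right h1 hW0.le
    have h3 : 0 ≤ (σ i : ℝ) * W := by positivity
    constructor <;> linarith
  have hex : ∀ i, i < 2 ^ (k + 2) → ∃ c, a + σ i * W ≤ c ∧
      c + treeLength (k + 1) ≤ a + σ i * W + W / 2 ∧
      ∀ t ∈ Icc c (c + treeLength (k + 1)), |f t - waveSum (k + 1) t| ≤ 1 / 2 ^ (k + 1) := by
    intro i hi
    have hb := hblock i hi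
    exact exists_child_of_eVariationOn_le hW (by simpa using (hσ i hi).2)
      (ha _ ⟨hb.1, by linarith⟩)
  choose! c hc1 hc2 hc3 using hex
  refine ⟨c, fun i hi => ⟨hc3 i hi, ?_, ?_⟩, fun i j hij hj => ?_⟩
  · linarith [hc1 i hi, (hblock i hi).1]
  · linarith [hc2 i hi, (hblock i hi).2]
  · have h1 := hc2 i (hij.trans hj)
    have h2 := hc1 j hj
    have h3 : (σ i : ℝ) + ((j : ℝ) - i) ≤ σ j := by
      have := hσadd i j hij hj
      rw [← Nat.cast_sub hij.le]
      exact_mod_cast this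
    have h4 := mul_le_mul_of_nonneg_right h3 hW0.le
    have h5 : treeLength k / (4 * (2 ^ (k + 2) : ℕ)) = W / 2 := by
      rw [← hnW]; push_cast; field_simp; norm_num
    have h6 : (1 : ℝ) ≤ (j : ℝ) - i := by
      have : (i : ℝ) + 1 ≤ j := by exact_mod_cast hij
      linarith
    rw [h5]
    nlinarith

theorem treeLength_eq_rpow (k : ℕ) :
    treeLength k = (2 : ℝ) ^ (-((k : ℝ) * (k + 3) / 2 + 9 * k)) := by
  induction k with
  | zero => simp [treeLength]
  | succ k ih =>
    rw [treeLength, ih, ← Real.rpow_natCast, ← Real.rpow_sub two_pos]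
    congr 1
    push_cast
    ring

theorem prod_two_pow_eq_rpow (k : ℕ) :
    ∏ j ∈ Finset.range k, ((2 ^ (j + 2) : ℕ) : ℝ) = (2 : ℝ) ^ ((k : ℝ) * (k + 3) / 2) := by
  induction k with
  | zero => simp
  | succ k ih =>
    rw [Finset.prod_range_succ, ih, Nat.cast_pow, Nat.cast_ofNat, ← Real.rpow_natCast,
      ← Real.rpow_add two_pos]
    congr 1
    push_cast
    ring

theorem exists_one_le_mul_prod_mul_treeLength_rpow {s : NNReal} (hs : s < 1) :
    ∃ C : NNReal, ∀ k, 1 ≤ (C : ℝ) *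
      ((∏ j ∈ Finset.range k, ((2 ^ (j + 2) : ℕ) : ℝ)) * treeLength k ^ (s : ℝ)) := by
  have hs' : 0 < 1 - (s : ℝ) := sub_pos.2 (by exact_mod_cast hs)
  refine ⟨2 ^ (81 / (2 * (1 - (s : ℝ)))), fun k => ?_⟩
  rw [prod_two_pow_eq_rpow, treeLength_eq_rpow, ← Real.rpow_mul two_pos.le, NNReal.coe_rpow,
    NNReal.coe_ofNat, ← Real.rpow_add two_pos, ← Real.rpow_add two_pos]
  refine Real.one_le_rpow one_le_two ?_
  have hk : (0 : ℝ) ≤ k := by positivity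
  have h0 : (0 : ℝ) ≤ s := s.coe_nonneg
  have h1 : 0 ≤ (1 - (s : ℝ)) / 2 * (k - 9 / (1 - s)) ^ 2 := by positivity
  have h2 : (1 - (s : ℝ)) / 2 * (k - 9 / (1 - s)) ^ 2 =
      (1 - s) * k ^ 2 / 2 - 9 * k + 81 / (2 * (1 - (s : ℝ))) := by
    field_simp
    ring
  nlinarith [mul_nonneg hk hs'.le]

theorem norm_wave_le (k : ℕ) (t : ℝ) :
    ‖2 / 2 ^ k * Real.sin (waveFreq k * t)‖ ≤ 2 * (1 / 2 : ℝ) ^ k := by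
  rw [norm_mul, Real.norm_eq_abs, Real.norm_eq_abs, abs_of_pos (by positivity : (0 : ℝ) < 2 / 2 ^ k),
    one_div, inv_pow, ← div_eq_mul_inv]
  exact mul_le_of_le_one_right (by positivity) (Real.abs_sin_le_one _)

theorem summable_wave_bound : Summable fun k : ℕ => 2 * (1 / 2 : ℝ) ^ k :=
  summable_geometric_two.mul_left 2

/-- A lacunary sine series agreeing with every function of small variation on a set of full
dimension. -/
noncomputable def waveSeries (t : ℝ) : ℝ := ∑' k, 2 / 2 ^ k * Real.sin (waveFreq k * t)

theorem continuous_waveSeries : Continuous waveSeries :=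
  continuous_tsum (fun _ => by fun_prop) summable_wave_bound norm_wave_le

theorem eq_waveSeries_of_abs_sub_le {y t : ℝ} (h : ∀ k, |y - waveSum k t| ≤ 1 / 2 ^ k) :
    y = waveSeries t := by
  have h1 : Filter.Tendsto (fun k => waveSum k t) Filter.atTop (nhds (waveSeries t)) :=
    (Summable.of_norm_bounded summable_wave_bound
      fun k => norm_wave_le k t).hasSum.tendsto_sum_nat
  have h2 : Filter.Tendsto (fun k => waveSum k t) Filter.atTop (nhds y) := by
    rw [tendsto_iff_dist_tendsto_zero]
    refine squeeze_zero (fun _ => dist_nonneg) (fun k => ?_)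
      (tendsto_pow_atTop_nhds_zero_of_lt_one (by norm_num) (by norm_num : (1 / 2 : ℝ) < 1))
    rw [dist_comm, Real.dist_eq, div_pow, one_pow]
    exact h k
  exact tendsto_nhds_unique h2 h1

/-- There is a continuous function `g : [0,1] → ℝ` such that for every
`f` with `f 0 = 0` and total variation `< 1`, the intersection set
`{t ∈ [0,1] : f t = g t}` has Hausdorff dimension `1`. -/
theorem exists_continuous_full_dimension_intersections :
    ∃ g : ℝ → ℝ, ContinuousOn g (Set.Icc 0 1) ∧
      ∀ f : ℝ → ℝ, f 0 = 0 → eVariationOn f (Set.Icc 0 1) < 1 →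
        dimH {t ∈ Set.Icc (0:ℝ) 1 | f t = g t} = 1 := by
  refine ⟨waveSeries, continuous_waveSeries.continuousOn, fun f hf0 hf => le_antisymm ?_ ?_⟩
  · exact (dimH_mono (subset_univ _)).trans_eq Real.dimH_univ
  refine ENNReal.le_of_forall_nnreal_lt fun s hs => ?_
  rcases eq_or_ne s 0 with rfl | hs0
  · simp
  have hs1 : s < 1 := by exact_mod_cast hs
  obtain ⟨C, hC⟩ := exists_one_le_mul_prod_mul_treeLength_rpow hs1
  refine le_dimH_of_tree (D := fun k => 2 ^ (k + 2)) (ℓ := treeLength) (a₀ := 0) (C := C)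
    (P := fun k a => 0 ≤ a ∧ a + treeLength k ≤ 1 ∧
      ∀ t ∈ Icc a (a + treeLength k), |f t - waveSum k t| ≤ 1 / 2 ^ k)
    (fun k => Nat.le_self_pow (by omega) 2) treeLength_pos ⟨le_rfl, by simp [treeLength], ?_⟩
    ?_ ?_ (pos_iff_ne_zero.2 hs0) hs1.le hC
  · intro t ht
    have := abs_sub_le_of_eVariationOn_le (f := f) (r := 1) zero_le_one (by simpa using hf.le)
      (by simpa [treeLength] using ht) (left_mem_Icc.2 (zero_le_one' ℝ))
    simpa [waveSum, hf0] using this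
  · rintro k a ⟨ha0, ha1, ha⟩
    obtain ⟨c, hc, hsep⟩ := exists_children hf ha0 ha1 ha
    refine ⟨c, fun i hi => ?_, hsep⟩
    obtain ⟨h1, h2, h3⟩ := hc i hi
    exact ⟨⟨ha0.trans h2, h3.trans ha1, h1⟩, h2, h3⟩
  · intro a x h
    have h0 := h 0
    exact ⟨⟨h0.1.1.trans h0.2.1, h0.2.2.trans h0.1.2.1⟩,
      eq_waveSeries_of_abs_sub_le fun k => (h k).1.2.2 x (h k).2⟩
end

section
/- Let g : [a,b] → ℝ be a continuous function. Then g has a permeable graph if and only if graph(g) is a permeable subset of ℝ²: for every x, y ∈ ℝ² and every ε > 0 there exists a path γ from x to y in ℝ² with ℓ(γ) < ‖x − y‖₂ + ε such that the closure of (image of γ) ∩ graph(g) is at most countable. -/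
open Set
open scoped ENNReal

/-- A function `g` has a permeable graph on `[a,b]` if for every `y` and every `δ > 0`
there is `f` with `f a = f b = y`, total variation `< δ`, and such that the closure of
the intersection set `{t ∈ [a,b] : f t = g t}` is at most countable. -/
def PermeableGraph (a b : ℝ) (g : ℝ → ℝ) : Prop :=
  ∀ y : ℝ, ∀ δ : ℝ, 0 < δ →
    ∃ f : ℝ → ℝ, f a = y ∧ f b = y ∧
      eVariationOn f (Set.Icc a b) < ENNReal.ofReal δ ∧
      (closure {t ∈ Set.Icc a b | f t = g t}).Countable

/-- The graph of `g : [a,b] → ℝ` as a subset of the Euclidean plane. -/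
def planeGraph (a b : ℝ) (g : ℝ → ℝ) : Set (EuclideanSpace ℝ (Fin 2)) :=
  {p | p 0 ∈ Set.Icc a b ∧ p 1 = g (p 0)}

/-- The graph of `g` is a permeable subset of `ℝ²`: any two points can be joined by
paths of length arbitrarily close to their distance which meet the graph in a set with
at most countable closure. -/
def PermeableSubsetGraph (a b : ℝ) (g : ℝ → ℝ) : Prop :=
  ∀ x y : EuclideanSpace ℝ (Fin 2), ∀ ε : ℝ, 0 < ε →
    ∃ γ : ℝ → EuclideanSpace ℝ (Fin 2),
      ContinuousOn γ (Set.Icc 0 1) ∧ γ 0 = x ∧ γ 1 = y ∧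
      eVariationOn γ (Set.Icc 0 1) < ENNReal.ofReal (dist x y + ε) ∧
      (closure (γ '' Set.Icc 0 1 ∩ planeGraph a b g)).Countable

/-- `q` can be reached from `p` along a path, parametrized by a `1`-Lipschitz map on `[0, ℓ]`,
whose image meets `Θ` in a countable set. -/
def Reachable {E : Type*} [PseudoEMetricSpace E] (Θ : Set E) (p q : E) (ℓ : ℝ) : Prop :=
  0 ≤ ℓ ∧ ∃ γ : ℝ → E, LipschitzWith 1 γ ∧ γ 0 = p ∧ γ ℓ = q ∧ (γ '' Icc 0 ℓ ∩ Θ).Countable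

/-- `q` can be reached from `p` within every length exceeding `r`; that is, the `Θ`-intrinsic
distance from `p` to `q` is at most `r`. -/
def AlmostReachable {E : Type*} [PseudoEMetricSpace E] (Θ : Set E) (p q : E) (r : ℝ) : Prop :=
  ∀ ε > 0, Reachable Θ p q (r + ε)

namespace Reachable

variable {E : Type*} [NormedAddCommGroup E] {Θ : Set E} {p q r : E} {ℓ ℓ' : ℝ}

theorem mono (h : Reachable Θ p q ℓ) (hl : ℓ ≤ ℓ') : Reachable Θ p q ℓ' := by
  obtain ⟨h0, γ, hγ, hp, hq, hc⟩ := h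
  refine ⟨h0.trans hl, fun u => γ (min u ℓ), ?_, ?_, ?_, ?_⟩
  · simpa [Function.comp_def] using hγ.comp (LipschitzWith.id.min_const ℓ)
  · simp [h0, hp]
  · simp [hl, hq]
  · refine hc.mono (inter_subset_inter_left _ ?_)
    rintro _ ⟨u, hu, rfl⟩
    exact ⟨min u ℓ, ⟨le_min hu.1 h0, min_le_right _ _⟩, rfl⟩

theorem symm (h : Reachable Θ p q ℓ) : Reachable Θ q p ℓ := by
  obtain ⟨h0, γ, hγ, hp, hq, hc⟩ := h
  refine ⟨h0, fun u => γ (ℓ - u), ?_, by simp [hq], by simp [hp], ?_⟩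
  · refine LipschitzWith.of_dist_le_mul fun u v => ?_
    refine (hγ.dist_le_mul _ _).trans ?_
    rw [dist_sub_left]
  · refine hc.mono (inter_subset_inter_left _ ?_)
    rintro _ ⟨u, hu, rfl⟩
    exact ⟨ℓ - u, ⟨by linarith [hu.2], by linarith [hu.1]⟩, rfl⟩

theorem trans (h : Reachable Θ p q ℓ) (h' : Reachable Θ q r ℓ') :
    Reachable Θ p r (ℓ + ℓ') := by
  obtain ⟨h0, γ, hγ, hp, hq, hc⟩ := h
  obtain ⟨h0', γ', hγ', hp', hq', hc'⟩ := h'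
  refine ⟨add_nonneg h0 h0', fun u => γ (min u ℓ) + γ' (max (u - ℓ) 0) - q, ?_, ?_, ?_, ?_⟩
  · refine LipschitzWith.of_dist_le_mul fun u v => ?_
    wlog huv : u ≤ v generalizing u v
    · rw [dist_comm, dist_comm u]
      exact this v u (le_of_not_ge huv)
    have h1 := hγ.dist_le_mul (min u ℓ) (min v ℓ)
    have h2 := hγ'.dist_le_mul (max (u - ℓ) 0) (max (v - ℓ) 0)
    have h3 : dist (min u ℓ) (min v ℓ) + dist (max (u - ℓ) 0) (max (v - ℓ) 0) = dist u v := by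
      simp only [Real.dist_eq]
      grind
    rw [dist_sub_right]
    refine (dist_add_add_le _ _ _ _).trans ?_
    simp only [NNReal.coe_one, one_mul] at h1 h2 ⊢
    linarith
  · simp [h0, hp, hp']
  · simp [h0', hq, hq']
  · refine (hc.union hc').mono ?_
    rintro _ ⟨⟨u, hu, rfl⟩, hx⟩
    rcases le_total u ℓ with h | h
    · refine Or.inl ⟨⟨u, ⟨hu.1, h⟩, ?_⟩, hx⟩
      simp [h, hp']
    · refine Or.inr ⟨⟨u - ℓ, ⟨by linarith, by linarith [hu.2]⟩, ?_⟩, hx⟩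
      simp [h, hq]

theorem of_segment [NormedSpace ℝ E] (h : (segment ℝ p q ∩ Θ).Countable) :
    Reachable Θ p q (dist p q) := by
  have hd : ‖q - p‖ = dist p q := by rw [dist_comm, dist_eq_norm]
  refine ⟨dist_nonneg, fun u => p + (u / dist p q) • (q - p), ?_, by simp, ?_, ?_⟩
  · refine LipschitzWith.of_dist_le_mul fun u v => ?_
    rw [dist_add_left, dist_eq_norm, ← sub_smul, norm_smul, hd, ← sub_div, norm_div,
      Real.norm_of_nonneg (dist_nonneg (x := p) (y := q)), ← dist_eq_norm]
    rcases eq_or_ne (dist p q) 0 with h0 | h0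
    · simp [h0]
    · rw [div_mul_cancel₀ _ h0]; simp
  · rcases eq_or_ne p q with rfl | h0
    · simp
    · simp [div_self (dist_ne_zero.2 h0)]
  · refine h.mono (inter_subset_inter_left _ ?_)
    rintro _ ⟨u, hu, rfl⟩
    rw [segment_eq_image']
    exact ⟨u / dist p q, ⟨div_nonneg hu.1 dist_nonneg, div_le_one_of_le₀ hu.2 dist_nonneg⟩, rfl⟩

theorem exists_path (hΘ : IsCompact Θ) (h : Reachable Θ p q ℓ) :
    ∃ γ : ℝ → E, ContinuousOn γ (Icc 0 1) ∧ γ 0 = p ∧ γ 1 = q ∧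
      eVariationOn γ (Icc 0 1) ≤ ENNReal.ofReal ℓ ∧
      (closure (γ '' Icc 0 1 ∩ Θ)).Countable := by
  obtain ⟨h0, γ, hγ, hp, hq, hc⟩ := h
  have hcont : Continuous fun u : ℝ => γ (ℓ * u) := hγ.continuous.comp (by fun_prop)
  refine ⟨fun u => γ (ℓ * u), hcont.continuousOn, by simp [hp], by simp [hq], ?_, ?_⟩
  · have hmono : MonotoneOn (fun u : ℝ => ℓ * u) univ :=
      (monotone_id.const_mul h0).monotoneOn _
    have h1 := (hγ.lipschitzOnWith (s := univ)).comp_eVariationOn_le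
      (mapsTo_univ (fun u : ℝ => ℓ * u) (Icc 0 1))
    have h2 := (hmono.eVariationOn_eq (mem_univ 0) (mem_univ 1)).le
    simp only [univ_inter, mul_one, mul_zero, sub_zero] at h2
    exact h1.trans (by simpa using h2)
  · rw [(((isCompact_Icc.image hcont).inter_right hΘ.isClosed)).isClosed.closure_eq]
    refine hc.mono (inter_subset_inter_left _ ?_)
    rintro _ ⟨u, hu, rfl⟩
    exact ⟨ℓ * u, ⟨mul_nonneg h0 hu.1, mul_le_of_le_one_right h0 hu.2⟩, rfl⟩

end Reachable

theorem Reachable.almostReachable {E : Type*} [NormedAddCommGroup E] {Θ : Set E} {p q : E} {r : ℝ}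
    (h : Reachable Θ p q r) : AlmostReachable Θ p q r :=
  fun ε hε => h.mono (by linarith)

namespace AlmostReachable

variable {E : Type*} [NormedAddCommGroup E] {Θ : Set E} {p q r : E} {ℓ ℓ' : ℝ}

theorem mono (h : AlmostReachable Θ p q ℓ) (hl : ℓ ≤ ℓ') : AlmostReachable Θ p q ℓ' :=
  fun ε hε => (h ε hε).mono (by linarith)

theorem symm (h : AlmostReachable Θ p q ℓ) : AlmostReachable Θ q p ℓ :=
  fun ε hε => (h ε hε).symm

theorem trans (h : AlmostReachable Θ p q ℓ) (h' : AlmostReachable Θ q r ℓ') :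
    AlmostReachable Θ p r (ℓ + ℓ') :=
  fun ε hε => ((h (ε / 2) (by linarith)).trans (h' (ε / 2) (by linarith))).mono (by linarith)

theorem of_forall_add (h : ∀ ε > 0, AlmostReachable Θ p q (ℓ + ε)) : AlmostReachable Θ p q ℓ :=
  fun ε hε => (h (ε / 2) (by linarith) (ε / 2) (by linarith)).mono (by linarith)

end AlmostReachable

open MeasureTheory Topology Filter

theorem AlmostReachable.of_volume_lineMap_preimage_eq_zero {E : Type*} [NormedAddCommGroup E]
    [NormedSpace ℝ E] {Θ : Set E} (hΘ : IsClosed Θ) {C : ℝ} (hC : 0 ≤ C)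
    (hreach : ∀ x y, AlmostReachable Θ x y (C * dist x y)) {p q : E}
    (hnull : volume {t ∈ Icc (0 : ℝ) 1 | AffineMap.lineMap p q t ∈ Θ} = 0) :
    AlmostReachable Θ p q (dist p q) := by
  refine AlmostReachable.of_forall_add fun ε hε => ?_
  set c : ℝ →ᵃ[ℝ] E := AffineMap.lineMap p q with hcdef
  have hcc : Continuous c := AffineMap.lineMap_continuous
  have hd : 0 ≤ dist p q := dist_nonneg
  have hCd : 0 < C * dist p q + 1 := by positivity
  set η : ℝ := ε / (C * dist p q + 1) with hη
  have hη0 : 0 < η := div_pos hε hCd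
  obtain ⟨U, hKU, hUo, hU⟩ := Set.exists_isOpen_lt_of_lt {t ∈ Icc (0 : ℝ) 1 | c t ∈ Θ}
    (ENNReal.ofReal η) (by rw [hnull]; exact ENNReal.ofReal_pos.2 hη0)
  have hUreal : ∀ s : Set ℝ, volume.real (U ∩ s) ≤ η := fun s =>
    ENNReal.toReal_le_of_le_ofReal hη0.le ((measure_mono inter_subset_left).trans hU.le)
  have hUfin : ∀ s : Set ℝ, volume (U ∩ s) ≠ ⊤ := fun s =>
    ((measure_mono inter_subset_left).trans_lt (hU.trans ENNReal.ofReal_lt_top)).ne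
  let cov : Bool → Set (Icc (0 : ℝ) 1) := fun i => if i then {t | t.1 ∈ U} else {t | c t.1 ∉ Θ}
  have hcov_open : ∀ i, IsOpen (cov i) := by
    rintro (_ | _)
    · exact hΘ.isOpen_compl.preimage (hcc.comp continuous_subtype_val)
    · exact hUo.preimage continuous_subtype_val
  have hcov : univ ⊆ ⋃ i, cov i := by
    intro t _
    by_cases ht : c t.1 ∈ Θ
    · exact mem_iUnion.2 ⟨true, hKU ⟨t.2, ht⟩⟩
    · exact mem_iUnion.2 ⟨false, ht⟩
  obtain ⟨t, ht0, htm, ⟨m, hm⟩, hsub⟩ :=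
    exists_monotone_Icc_subset_open_cover_Icc zero_le_one hcov_open hcov
  have hstep : ∀ n, AlmostReachable Θ (c (t n)) (c (t (n + 1)))
      (dist p q * (((t (n + 1) : ℝ) - t n)
        + C * volume.real (U ∩ Ioc (t n : ℝ) (t (n + 1))))) := by
    intro n
    have hle : (t n : ℝ) ≤ t (n + 1) := htm n.le_succ
    have hdist : dist (c (t n)) (c (t (n + 1))) = ((t (n + 1) : ℝ) - t n) * dist p q := by
      rw [hcdef, dist_lineMap_lineMap, dist_comm, Real.dist_eq, abs_of_nonneg (by linarith)]
    have hmem : ∀ x ∈ Icc (t n : ℝ) (t (n + 1)), x ∈ Icc (0 : ℝ) 1 := fun x hx =>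
      ⟨(t n).2.1.trans hx.1, hx.2.trans (t (n + 1)).2.2⟩
    obtain ⟨_ | _, hi⟩ := hsub n
    · have hseg : segment ℝ (c (t n)) (c (t (n + 1))) ∩ Θ = ∅ := by
        rw [← image_segment, segment_eq_Icc hle, eq_empty_iff_forall_notMem]
        rintro _ ⟨⟨x, hx, rfl⟩, hxΘ⟩
        exact hi (a := ⟨x, hmem x hx⟩) hx hxΘ
      refine (Reachable.of_segment (by rw [hseg]; exact countable_empty)).almostReachable.mono ?_
      rw [hdist, mul_comm]
      refine mul_le_mul_of_nonneg_left ?_ hd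
      have : 0 ≤ C * volume.real (U ∩ Ioc (t n : ℝ) (t (n + 1))) := by positivity
      linarith
    · have hUI : U ∩ Ioc (t n : ℝ) (t (n + 1)) = Ioc (t n : ℝ) (t (n + 1)) :=
        inter_eq_right.2 fun x hx =>
          hi (a := ⟨x, hmem x (Ioc_subset_Icc_self hx)⟩) (Ioc_subset_Icc_self hx)
      refine (hreach _ _).mono ?_
      rw [hUI, Real.volume_real_Ioc_of_le hle, hdist]
      nlinarith [mul_nonneg hd (sub_nonneg.2 hle)]
  have key : ∀ n, AlmostReachable Θ (c 0) (c (t n))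
      (dist p q * ((t n : ℝ) + C * volume.real (U ∩ Ioc (0 : ℝ) (t n)))) := by
    intro n
    induction n with
    | zero =>
      have h0 : (t 0 : ℝ) = 0 := ht0
      have : Reachable Θ (c 0) (c 0) (dist (c 0) (c 0)) := Reachable.of_segment (by
        rw [segment_same]; exact (countable_singleton _).mono inter_subset_left)
      simpa [h0] using this.almostReachable
    | succ n ih =>
      refine (ih.trans (hstep n)).mono (le_of_eq ?_)
      have hle : (t n : ℝ) ≤ t (n + 1) := htm n.le_succ
      rw [← Ioc_union_Ioc_eq_Ioc (t n).2.1 hle, inter_union_distrib_left,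
        measureReal_union _ (hUo.measurableSet.inter measurableSet_Ioc) (hUfin _) (hUfin _)]
      · ring
      · exact (Ioc_disjoint_Ioc_of_le le_rfl).mono inter_subset_right inter_subset_right
  have h1 := key m
  have hm1 : (t m : ℝ) = 1 := by rw [hm m le_rfl]
  rw [hm1] at h1
  simp only [hcdef, AffineMap.lineMap_apply_zero, AffineMap.lineMap_apply_one] at h1
  refine h1.mono ?_
  have h2 : C * dist p q * η ≤ ε := by
    have h3 : (C * dist p q + 1) * η = ε := mul_div_cancel₀ _ hCd.ne'
    linarith
  have h3 := mul_le_mul_of_nonneg_left (hUreal (Ioc 0 1)) (mul_nonneg hC hd)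
  linarith

/-- A function of bounded variation is dominated by the increments of a bounded function. -/
theorem exists_abs_sub_le_sub_of_eVariationOn_le {F : ℝ → ℝ} {δ : ℝ} (hδ : 0 ≤ δ)
    (hF : eVariationOn F univ ≤ ENNReal.ofReal δ) :
    ∃ V : ℝ → ℝ, (∀ x, V x ∈ Icc 0 δ) ∧ ∀ x y, x ≤ y → |F y - F x| ≤ V y - V x := by
  have hle : ∀ s, eVariationOn F s ≤ ENNReal.ofReal δ := fun s =>
    (eVariationOn.mono F (subset_univ s)).trans hF
  have hfin : ∀ s, eVariationOn F s ≠ ⊤ := fun s => ((hle s).trans_lt ENNReal.ofReal_lt_top).ne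
  refine ⟨fun x => (eVariationOn F (Iic x)).toReal, fun x =>
    ⟨ENNReal.toReal_nonneg, ENNReal.toReal_le_of_le_ofReal hδ (hle _)⟩, fun x y hxy => ?_⟩
  have hunion := eVariationOn.union F (isGreatest_Iic (a := x)) (isLeast_Icc hxy)
  rw [Iic_union_Icc_eq_Iic hxy] at hunion
  have hd := ENNReal.toReal_mono (hfin _)
    (eVariationOn.edist_le F (right_mem_Icc.2 hxy) (left_mem_Icc.2 hxy))
  rw [edist_dist, ENNReal.toReal_ofReal dist_nonneg, Real.dist_eq] at hd
  simp only [hunion, ENNReal.toReal_add (hfin _) (hfin _)]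
  linarith

/-- The generalized inverse of an expanding function at bounded distance from the identity. -/
theorem exists_lipschitzWith_generalizedInverse {σ : ℝ → ℝ} {δ : ℝ}
    (hσ : ∀ x y, x ≤ y → y - x ≤ σ y - σ x) (hlo : ∀ x, x ≤ σ x) (hhi : ∀ x, σ x ≤ x + δ) :
    ∃ X : ℝ → ℝ, LipschitzWith 1 X ∧ (∀ x, X (σ x) = x) ∧
      ∀ u, ContinuousAt σ (X u) → u = σ (X u) := by
  have hmono : StrictMono σ := fun x y hxy => by linarith [hσ x y hxy.le]
  let X : ℝ → ℝ := fun u => sSup {x | σ x ≤ u}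
  have hbdd : ∀ u, BddAbove {x | σ x ≤ u} := fun u => ⟨u, fun x hx => (hlo x).trans hx⟩
  have hne : ∀ u, {x | σ x ≤ u}.Nonempty := fun u => ⟨u - δ, by
    have := hhi (u - δ)
    simp only [mem_ofPred_eq]
    linarith⟩
  have hlt : ∀ u x, x < X u → σ x ≤ u := fun u x hx => by
    obtain ⟨y, hy, hxy⟩ := exists_lt_of_lt_csSup (hne u) hx
    exact (hmono hxy).le.trans hy
  have hgt : ∀ u x, X u < x → u < σ x := fun u x hx => by
    by_contra! h
    exact absurd (le_csSup (hbdd u) h) (not_le.2 hx)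
  refine ⟨X, ?_, fun x => le_antisymm ?_ ?_, fun u hu => le_antisymm ?_ ?_⟩
  · refine LipschitzWith.of_dist_le_mul fun u v => ?_
    wlog huv : u ≤ v generalizing u v
    · rw [dist_comm, dist_comm u]
      exact this v u (le_of_not_ge huv)
    have h1 : X u ≤ X v := csSup_le_csSup (hbdd v) (hne u) fun x hx => le_trans hx huv
    rw [NNReal.coe_one, one_mul, dist_comm, dist_comm u, Real.dist_eq, Real.dist_eq,
      abs_of_nonneg (sub_nonneg.2 h1), abs_of_nonneg (sub_nonneg.2 huv)]
    by_contra! h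
    set e := (X v - X u - (v - u)) / 4 with he
    have h2 := hgt u (X u + e) (by linarith)
    have h3 := hlt v (X v - e) (by linarith)
    have h4 := hσ (X u + e) (X v - e) (by linarith)
    linarith
  · by_contra! h
    obtain ⟨z, hxz, hz⟩ := exists_between h
    exact absurd (hlt _ _ hz) (not_le.2 (hmono hxz))
  · by_contra! h
    obtain ⟨z, hxz, hz⟩ := exists_between h
    exact absurd (hgt _ _ hxz) (not_lt.2 (hmono hz).le)
  · refine ge_of_tendsto (hu.tendsto.mono_left (nhdsWithin_le_nhds (s := Ioi (X u)))) ?_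
    filter_upwards [self_mem_nhdsWithin] with x hx using (hgt u x hx).le
  · refine le_of_tendsto (hu.tendsto.mono_left (nhdsWithin_le_nhds (s := Iio (X u)))) ?_
    filter_upwards [self_mem_nhdsWithin] with x hx using hlt u x hx

theorem EuclideanSpace.dist_sq_fin_two (p q : EuclideanSpace ℝ (Fin 2)) :
    dist p q ^ 2 = (p 0 - q 0) ^ 2 + (p 1 - q 1) ^ 2 := by
  rw [EuclideanSpace.dist_eq, Real.sq_sqrt (by positivity)]
  simp [Fin.sum_univ_two, Real.dist_eq]

theorem EuclideanSpace.abs_sub_le_dist_fin_two (p q : EuclideanSpace ℝ (Fin 2)) (i : Fin 2) :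
    |p i - q i| ≤ dist p q := by
  rw [dist_eq_norm, ← Real.norm_eq_abs, ← PiLp.sub_apply]
  exact PiLp.norm_apply_le _ i

theorem EuclideanSpace.dist_le_add_fin_two (p q : EuclideanSpace ℝ (Fin 2)) :
    dist p q ≤ |p 0 - q 0| + |p 1 - q 1| := by
  refine le_of_sq_le_sq ?_ (by positivity)
  rw [EuclideanSpace.dist_sq_fin_two, ← sq_abs (p 0 - q 0), ← sq_abs (p 1 - q 1)]
  nlinarith [mul_nonneg (abs_nonneg (p 0 - q 0)) (abs_nonneg (p 1 - q 1))]

theorem isCompact_planeGraph {a b : ℝ} {g : ℝ → ℝ} (hg : ContinuousOn g (Icc a b)) :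
    IsCompact (planeGraph a b g) := by
  have hcont : ContinuousOn (fun t => (!₂[t, g t] : EuclideanSpace ℝ (Fin 2))) (Icc a b) := by
    refine (PiLp.continuous_toLp 2 _).comp_continuousOn (continuousOn_pi.2 fun i => ?_)
    fin_cases i
    · exact continuousOn_id
    · exact hg
  convert! isCompact_Icc.image_of_continuousOn hcont
  ext p
  constructor
  · rintro ⟨h0, h1⟩
    refine ⟨p 0, h0, ?_⟩
    ext i
    fin_cases i <;> simp [h1]
  · rintro ⟨t, ht, rfl⟩
    simpa [planeGraph] using ht

/-- The graph of a function of bounded variation, completed by vertical segments at the jumps,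
is traced out by a Lipschitz path. -/
theorem reachable_of_eVariationOn_le {a b : ℝ} {g F : ℝ → ℝ} {δ : ℝ} (hδ : 0 ≤ δ)
    (hF : eVariationOn F univ ≤ ENNReal.ofReal δ)
    (hc : {x ∈ Icc a b | F x = g x}.Countable) {s t : ℝ} (hst : s ≤ t) :
    Reachable (planeGraph a b g) !₂[s, F s] !₂[t, F t] (2 * (t - s + δ)) := by
  obtain ⟨V, hV, hFV⟩ := exists_abs_sub_le_sub_of_eVariationOn_le hδ hF
  set σ : ℝ → ℝ := fun x => x + V x with hσdef
  have hσ : ∀ x y, x ≤ y → y - x ≤ σ y - σ x := fun x y hxy => by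
    have := (abs_nonneg _).trans (hFV x y hxy)
    simp only [hσdef]
    linarith
  have hFσ : ∀ x y, |F x - F y| ≤ |σ x - σ y| := by
    intro x y
    wlog hxy : y ≤ x generalizing x y
    · rw [abs_sub_comm, abs_sub_comm (σ x)]
      exact this y x (le_of_not_ge hxy)
    refine (hFV y x hxy).trans (le_trans ?_ (le_abs_self _))
    simp only [hσdef]
    linarith
  have hmono : Monotone σ := fun x y hxy => by linarith [hσ x y hxy]
  obtain ⟨X, hX, hXσ, hXcont⟩ := exists_lipschitzWith_generalizedInverse (δ := δ) hσ
    (fun x => by linarith [(hV x).1]) (fun x => by linarith [(hV x).2])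
  obtain ⟨Y, hY, hYσ⟩ : ∃ Y : ℝ → ℝ, LipschitzWith 1 Y ∧ EqOn (F ∘ X) Y (range σ) := by
    refine LipschitzOnWith.extend_real (LipschitzOnWith.of_dist_le_mul ?_)
    rintro _ ⟨x, rfl⟩ _ ⟨y, rfl⟩
    simpa [hXσ, Real.dist_eq] using hFσ x y
  have hYF : ∀ x, Y (σ x) = F x := fun x => by
    rw [← hYσ ⟨x, rfl⟩, Function.comp_apply, hXσ]
  have hσst : 0 ≤ σ t - σ s := sub_nonneg.2 (hmono hst)
  refine Reachable.mono (ℓ := 2 * (σ t - σ s)) ⟨by linarith,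
    fun u => !₂[X (σ s + u / 2), Y (σ s + u / 2)], ?_, ?_, ?_, ?_⟩ ?_
  · refine LipschitzWith.of_dist_le_mul fun u v => ?_
    refine (EuclideanSpace.dist_le_add_fin_two _ _).trans ?_
    have h1 := hX.dist_le_mul (σ s + u / 2) (σ s + v / 2)
    have h2 := hY.dist_le_mul (σ s + u / 2) (σ s + v / 2)
    have h3 : |u / 2 - v / 2| = |u - v| / 2 := by rw [← sub_div, abs_div, abs_two]
    simp only [NNReal.coe_one, one_mul, Real.dist_eq, add_sub_add_left_eq_sub, h3] at h1 h2 ⊢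
    simp
    linarith
  · simp [hXσ, hYF]
  · simp [hXσ, hYF]
  · have hcount := (hc.union hmono.countable_not_continuousAt).image
      fun x => (!₂[x, g x] : EuclideanSpace ℝ (Fin 2))
    refine hcount.mono ?_
    rintro _ ⟨⟨u, -, rfl⟩, hmem, heq⟩
    simp only [Matrix.cons_val_zero, Matrix.cons_val_one] at hmem heq
    beta_reduce
    generalize σ s + u / 2 = w at hmem heq ⊢
    refine ⟨X w, ?_, by simp [heq]⟩
    by_cases hw : ContinuousAt σ (X w)
    · refine Or.inl ⟨hmem, ?_⟩
      rw [← heq, ← hYF, ← hXcont w hw]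
    · exact Or.inr hw
  · have h1 := (hV s).1
    have h2 := (hV t).2
    simp only [hσdef]
    linarith

theorem reachable_vertical (a b : ℝ) (g : ℝ → ℝ) {p q : EuclideanSpace ℝ (Fin 2)}
    (h : p 0 = q 0) : Reachable (planeGraph a b g) p q |p 1 - q 1| := by
  have hd : dist p q ≤ |p 1 - q 1| := by
    simpa [h] using EuclideanSpace.dist_le_add_fin_two p q
  refine (Reachable.of_segment ?_).mono hd
  refine (countable_singleton (!₂[p 0, g (p 0)] : EuclideanSpace ℝ (Fin 2))).mono ?_
  rintro x ⟨⟨α, β, -, -, hαβ, rfl⟩, -, hx⟩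
  have h0 : (α • p + β • q) 0 = p 0 := by
    simp [← h, ← add_mul, hαβ]
  rw [h0] at hx
  rw [mem_singleton_iff]
  ext i
  fin_cases i
  · simpa using h0
  · simpa using hx

theorem PermeableGraph.almostReachable_horizontal {a b : ℝ} (hab : a ≤ b) {g : ℝ → ℝ}
    (h : PermeableGraph a b g) {s t : ℝ} (hst : s ≤ t) (y : ℝ) :
    AlmostReachable (planeGraph a b g) !₂[s, y] !₂[t, y] (2 * (t - s)) := by
  intro ε hε
  obtain ⟨f, hfa, -, hfV, hfc⟩ := h y (ε / 4) (by linarith)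
  set F : ℝ → ℝ := f ∘ fun x => (projIcc a b hab x : ℝ) with hFdef
  have hF : eVariationOn F univ ≤ ENNReal.ofReal (ε / 4) :=
    (eVariationOn.comp_le_of_monotoneOn f _
      (fun x _ z _ hxz => monotone_projIcc hab hxz) fun x _ => (projIcc a b hab x).2).trans hfV.le
  have hFc : {x ∈ Icc a b | F x = g x}.Countable := by
    refine hfc.mono (Subset.trans ?_ subset_closure)
    rintro x ⟨hx, hxg⟩
    refine ⟨hx, ?_⟩
    rwa [hFdef, Function.comp_apply, projIcc_of_mem hab hx] at hxg
  have hFy : ∀ x, |F x - y| ≤ ε / 4 := fun x => by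
    have h1 := (eVariationOn.edist_le F (mem_univ x) (mem_univ a)).trans hF
    rw [edist_dist, ENNReal.ofReal_le_ofReal_iff (by linarith), Real.dist_eq] at h1
    simpa [hFdef, hfa] using h1
  have h1 : Reachable (planeGraph a b g) !₂[s, F s] !₂[s, y] (ε / 4) :=
    (reachable_vertical a b g (by simp)).mono (by simpa using hFy s)
  have h2 : Reachable (planeGraph a b g) !₂[t, F t] !₂[t, y] (ε / 4) :=
    (reachable_vertical a b g (by simp)).mono (by simpa using hFy t)
  exact ((h1.symm.trans (reachable_of_eVariationOn_le (by linarith) hF hFc hst)).trans h2).mono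
    (by linarith)

theorem PermeableGraph.almostReachable_three_mul_dist {a b : ℝ} (hab : a ≤ b) {g : ℝ → ℝ}
    (h : PermeableGraph a b g) (p q : EuclideanSpace ℝ (Fin 2)) :
    AlmostReachable (planeGraph a b g) p q (3 * dist p q) := by
  have hhor : AlmostReachable (planeGraph a b g) p !₂[q 0, p 1] (2 * |p 0 - q 0|) := by
    have hp : p = !₂[p 0, p 1] := by
      ext i
      fin_cases i <;> simp
    nth_rewrite 1 [hp]
    rcases le_total (p 0) (q 0) with hpq | hpq
    · rw [abs_sub_comm, abs_of_nonneg (sub_nonneg.2 hpq)]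
      exact h.almostReachable_horizontal hab hpq _
    · rw [abs_of_nonneg (sub_nonneg.2 hpq)]
      exact (h.almostReachable_horizontal hab hpq _).symm
  have hver : AlmostReachable (planeGraph a b g) !₂[q 0, p 1] q |p 1 - q 1| := by
    simpa using (reachable_vertical a b g (p := !₂[q 0, p 1]) (q := q) (by simp)).almostReachable
  refine (hhor.trans hver).mono ?_
  linarith [EuclideanSpace.abs_sub_le_dist_fin_two p q 0,
    EuclideanSpace.abs_sub_le_dist_fin_two p q 1]

theorem PermeableGraph.almostReachable {a b : ℝ} (hab : a ≤ b) {g : ℝ → ℝ}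
    (hg : ContinuousOn g (Icc a b)) (h : PermeableGraph a b g)
    (p q : EuclideanSpace ℝ (Fin 2)) : AlmostReachable (planeGraph a b g) p q (dist p q) := by
  refine AlmostReachable.of_forall_add fun ε hε => ?_
  let G : ℝ → ℝ := fun t =>
    g (projIcc a b hab (AffineMap.lineMap p q t 0)) - AffineMap.lineMap p q t 1
  have hG : Continuous G := by
    have hg' : Continuous fun x => g (projIcc a b hab x) :=
      (continuousOn_iff_continuous_domRestrict.1 hg).comp continuous_projIcc
    exact (hg'.comp (by fun_prop)).sub (by fun_prop)
  obtain ⟨k, hk, hk0, hkε⟩ := ((Measure.countable_meas_level_set_pos (μ := volume)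
    hG.measurable).dense_compl ℝ).exists_between (half_pos hε)
  set w : EuclideanSpace ℝ (Fin 2) := !₂[0, k] with hw
  have hnull : volume {t ∈ Icc (0 : ℝ) 1 |
      AffineMap.lineMap (p + w) (q + w) t ∈ planeGraph a b g} = 0 := by
    refine measure_mono_null ?_ (nonpos_iff_eq_zero.1 (not_lt.1 hk))
    rintro t ⟨-, hmem, heq⟩
    have hl : AffineMap.lineMap (p + w) (q + w) t = AffineMap.lineMap p q t + w := by
      simp only [AffineMap.lineMap_apply, vsub_eq_sub, vadd_eq_add, add_sub_add_right_eq_sub]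
      abel
    have h0 : (AffineMap.lineMap (p + w) (q + w) t) 0 = AffineMap.lineMap p q t 0 := by
      rw [hl]; simp [hw]
    have h1 : (AffineMap.lineMap (p + w) (q + w) t) 1 = AffineMap.lineMap p q t 1 + k := by
      rw [hl]; simp [hw]
    rw [h0] at hmem heq
    rw [h1] at heq
    change G t = k
    simp only [G]
    rw [projIcc_of_mem hab hmem, ← heq]
    ring
  have hshift : ∀ x : EuclideanSpace ℝ (Fin 2),
      AlmostReachable (planeGraph a b g) x (x + w) k := fun x => by
    simpa [hw, abs_of_pos hk0] using
      (reachable_vertical a b g (p := x) (q := x + w) (by simp [hw])).almostReachable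
  have hmain := AlmostReachable.of_volume_lineMap_preimage_eq_zero
    (isCompact_planeGraph hg).isClosed (by norm_num)
    (h.almostReachable_three_mul_dist hab) hnull
  rw [dist_add_right] at hmain
  exact (((hshift p).trans hmain).trans (hshift q).symm).mono (by linarith)

theorem PermeableGraph.permeableSubsetGraph {a b : ℝ} (hab : a ≤ b) {g : ℝ → ℝ}
    (hg : ContinuousOn g (Icc a b)) (h : PermeableGraph a b g) :
    PermeableSubsetGraph a b g := by
  intro x y ε hε
  obtain ⟨γ, hγ, h0, h1, hlen, hcount⟩ :=
    (h.almostReachable hab hg x y (ε / 2) (half_pos hε)).exists_path (isCompact_planeGraph hg)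
  refine ⟨γ, hγ, h0, h1, hlen.trans_lt ?_, hcount⟩
  have hd : 0 ≤ dist x y := dist_nonneg
  exact (ENNReal.ofReal_lt_ofReal_iff (by linarith)).2 (by linarith)

theorem PermeableSubsetGraph.permeableGraph {a b : ℝ} (hab : a < b) {g : ℝ → ℝ}
    (hg : ContinuousOn g (Icc a b)) (h : PermeableSubsetGraph a b g) :
    PermeableGraph a b g := by
  intro y δ hδ
  have hba : 0 < b - a := sub_pos.2 hab
  set η : ℝ := δ / (3 * (b - a)) with hη
  have hη0 : 0 < η := by positivity
  have hηδ : η * (b - a) = δ / 3 := by rw [hη]; field_simp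
  set A : ℝ := 1 + 1 / (2 * η) with hA
  have hA0 : 0 < A := by positivity
  obtain ⟨γ, hγ, h0, h1, hlen, hcount⟩ := h !₂[a, y] !₂[b, y] (δ / (3 * A)) (by positivity)
  have hdist : dist (!₂[a, y] : EuclideanSpace ℝ (Fin 2)) !₂[b, y] ≤ b - a := by
    simpa [abs_sub_comm a, abs_of_pos hba] using
      EuclideanSpace.dist_le_add_fin_two !₂[a, y] !₂[b, y]
  have hpos : ∀ i, ContinuousOn (fun u => γ u i) (Icc 0 1) := fun i =>
    (EuclideanSpace.proj (𝕜 := ℝ) i).continuous.comp_continuousOn hγ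
  have ha : γ 0 0 = a := by simp [h0]
  have hb : γ 1 0 = b := by simp [h1]
  -- first hitting times
  have hhit : ∀ t ∈ Icc a b, ∃ u, IsLeast {u ∈ Icc (0 : ℝ) 1 | γ u 0 = t} u := by
    intro t ht
    have hclosed : IsClosed {u ∈ Icc (0 : ℝ) 1 | γ u 0 = t} :=
      (hpos 0).preimage_isClosed_of_isClosed isClosed_Icc isClosed_singleton
    refine (isCompact_Icc.of_isClosed_subset hclosed fun u hu => hu.1).exists_isLeast ?_
    obtain ⟨u, hu, hut⟩ := intermediate_value_Icc zero_le_one (hpos 0)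
      (show t ∈ Icc (γ 0 0) (γ 1 0) by rwa [ha, hb])
    exact ⟨u, hu, hut⟩
  choose! τ₀ hτ₀ using hhit
  set τ : ℝ → ℝ := fun t => if t = b then 1 else τ₀ t with hτdef
  have hτ : ∀ t ∈ Icc a b, τ t ∈ Icc (0 : ℝ) 1 ∧ γ (τ t) 0 = t := by
    intro t ht
    by_cases htb : t = b
    · simp [hτdef, htb, hb]
    · simpa [hτdef, htb] using (hτ₀ t ht).1
  have hτmono : MonotoneOn τ (Icc a b) := by
    intro s hs t ht hst
    by_cases htb : t = b
    · simpa [hτdef, htb] using (hτ s hs).1.2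
    · have hsb : s ≠ b := fun hsb => htb (le_antisymm ht.2 (hsb ▸ hst))
      simp only [hτdef, htb, hsb, if_false]
      obtain ⟨⟨hu, hut⟩, -⟩ := hτ₀ t ht
      obtain ⟨v, hv, hvs⟩ := intermediate_value_Icc hu.1
        ((hpos 0).mono (Icc_subset_Icc_right hu.2))
        (show s ∈ Icc (γ 0 0) (γ (τ₀ t) 0) by rw [ha, hut]; exact ⟨hs.1, hst⟩)
      exact ((hτ₀ s hs).2 ⟨⟨hv.1, hv.2.trans hu.2⟩, hvs⟩).trans hv.2
  have hτa : γ (τ a) = !₂[a, y] := by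
    have haI := left_mem_Icc.2 hab.le
    have h2 : τ a = τ₀ a := by simp [hτdef, hab.ne]
    have h3 : τ₀ a ≤ 0 := (hτ₀ a haI).2 ⟨left_mem_Icc.2 zero_le_one, ha⟩
    rw [h2, le_antisymm h3 (hτ₀ a haI).1.1.1, h0]
  have hτb : γ (τ b) = !₂[b, y] := by simp [hτdef, h1]
  -- the variation of `γ` along the hitting times
  have hfin : ∀ s ⊆ Icc (0 : ℝ) 1, eVariationOn γ s ≠ ⊤ := fun s hs =>
    ((eVariationOn.mono γ hs).trans_lt (hlen.trans ENNReal.ofReal_lt_top)).ne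
  set R : ℝ → ℝ := fun t => (eVariationOn γ (Icc 0 (τ t))).toReal with hR
  have hRdist : ∀ s ∈ Icc a b, ∀ t ∈ Icc a b, s ≤ t →
      dist (γ (τ t)) (γ (τ s)) ≤ R t - R s := by
    intro s hs t ht hst
    have hs1 := (hτ s hs).1
    have ht1 := (hτ t ht).1
    have hle := hτmono hs ht hst
    have hunion := eVariationOn.union γ (isGreatest_Icc hs1.1) (isLeast_Icc hle)
    rw [Icc_union_Icc_eq_Icc hs1.1 hle] at hunion
    have hf1 := hfin _ (Icc_subset_Icc_right hs1.2)
    have hf2 := hfin _ (Icc_subset_Icc hs1.1 ht1.2)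
    have hd := ENNReal.toReal_mono hf2
      (eVariationOn.edist_le γ (right_mem_Icc.2 hle) (left_mem_Icc.2 hle))
    rw [edist_dist, ENNReal.toReal_ofReal dist_nonneg] at hd
    simp only [hR, hunion, ENNReal.toReal_add hf1 hf2]
    linarith
  have hRb : R b - R a < b - a + δ / (3 * A) := by
    have h2 : R b < b - a + δ / (3 * A) := by
      simp only [hR, hτdef, if_true]
      refine ENNReal.toReal_lt_of_lt_ofReal (hlen.trans_le (ENNReal.ofReal_le_ofReal ?_))
      linarith
    have h3 : 0 ≤ R a := ENNReal.toReal_nonneg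
    linarith
  set Φ : ℝ → ℝ := fun t => A * R t - (A - η) * t with hΦ
  have hkey : ∀ s ∈ Icc a b, ∀ t ∈ Icc a b, s ≤ t →
      |γ (τ t) 1 - γ (τ s) 1| ≤ Φ t - Φ s := by
    intro s hs t ht hst
    have hr := hRdist s hs t ht hst
    have hx := EuclideanSpace.abs_sub_le_dist_fin_two (γ (τ t)) (γ (τ s)) 0
    have hsq := EuclideanSpace.dist_sq_fin_two (γ (τ t)) (γ (τ s))
    rw [(hτ t ht).2, (hτ s hs).2] at hx hsq
    rw [abs_of_nonneg (sub_nonneg.2 hst)] at hx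
    set d := dist (γ (τ t)) (γ (τ s))
    set z := γ (τ t) 1 - γ (τ s) 1
    have hz : |z| ≤ A * (d - (t - s)) + η * (t - s) := by
      have hprod : η * (1 / (2 * η)) = 1 / 2 := by field_simp
      have hinv : 0 < 1 / (2 * η) := by positivity
      have hts : 0 ≤ t - s := sub_nonneg.2 hst
      refine abs_le_of_sq_le_sq ?_ (by
        have := mul_nonneg hA0.le (sub_nonneg.2 hx)
        positivity)
      have hz2 : z ^ 2 = (d - (t - s)) ^ 2 + 2 * (t - s) * (d - (t - s)) := by
        linear_combination -hsq
      generalize t - s = x at *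
      obtain ⟨e, he⟩ : ∃ e, e = d - x := ⟨_, rfl⟩
      have he0 : 0 ≤ e := by linarith
      rw [hz2, ← he, hA]
      generalize 1 / (2 * η) = m at *
      have h5 : (m * e + η * x) ^ 2 - 2 * x * e = (m * e - η * x) ^ 2 := by
        linear_combination (4 * e * x) * hprod
      nlinarith [sq_nonneg (m * e - η * x), mul_nonneg he0 he0, mul_nonneg hinv.le he0,
        mul_nonneg hη0.le hts, mul_nonneg he0 (mul_nonneg hinv.le he0),
        mul_nonneg he0 (mul_nonneg hη0.le hts)]
    refine hz.trans ?_
    have := mul_le_mul_of_nonneg_left hr hA0.le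
    simp only [hΦ]
    linarith
  have hΦmono : MonotoneOn Φ (Icc a b) := fun s hs t ht hst =>
    sub_nonneg.1 ((abs_nonneg _).trans (hkey s hs t ht hst))
  refine ⟨fun t => γ (τ t) 1, by simp [hτa], by simp [hτb], ?_, ?_⟩
  · have hle : eVariationOn (fun t => γ (τ t) 1) (Icc a b) ≤ eVariationOn Φ (Icc a b) := by
      refine iSup_le fun ⟨n, u, hu, hus⟩ => ?_
      refine le_trans (Finset.sum_le_sum fun i _ => ?_) (eVariationOn.sum_le hu hus)
      rw [edist_dist, edist_dist, Real.dist_eq, Real.dist_eq]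
      exact ENNReal.ofReal_le_ofReal
        ((hkey _ (hus i) _ (hus (i + 1)) (hu i.le_succ)).trans (le_abs_self _))
    have hΦvar := hΦmono.eVariationOn_eq (left_mem_Icc.2 hab.le) (right_mem_Icc.2 hab.le)
    rw [inter_self] at hΦvar
    refine (hle.trans_eq hΦvar).trans_lt ((ENNReal.ofReal_lt_ofReal_iff hδ).2 ?_)
    have h2 := mul_lt_mul_of_pos_left hRb hA0
    have h3 : A * (δ / (3 * A)) = δ / 3 := by field_simp
    simp only [hΦ]
    linarith
  · have hcompact : IsCompact (γ '' Icc 0 1 ∩ planeGraph a b g) :=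
      (isCompact_Icc.image_of_continuousOn hγ).inter_right (isCompact_planeGraph hg).isClosed
    have hproj : IsCompact
        ((fun p : EuclideanSpace ℝ (Fin 2) => p 0) '' (γ '' Icc 0 1 ∩ planeGraph a b g)) :=
      hcompact.image (by fun_prop)
    refine ((hcount.mono subset_closure).image fun p => p 0).mono
      (closure_minimal ?_ hproj.isClosed)
    rintro t ⟨ht, htg⟩
    obtain ⟨h2, h3⟩ := hτ t ht
    exact ⟨γ (τ t), ⟨⟨τ t, h2, rfl⟩, by rwa [h3], by rw [h3]; exact htg⟩, h3⟩

/-- A continuous function `g : [a,b] → ℝ` has a permeable graph iff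
its graph is a permeable subset of `ℝ²`. -/
theorem permeable_graph_iff_permeable_subset
    (a b : ℝ) (hab : a < b) (g : ℝ → ℝ) (hg : ContinuousOn g (Set.Icc a b)) :
    PermeableGraph a b g ↔ PermeableSubsetGraph a b g := by
  exact ⟨fun h => h.permeableSubsetGraph hab.le hg, fun h => h.permeableGraph hab hg⟩
end

section
/- There exists a Hölder continuous function θ : [0,1] → ℝ (with exponent log(10)/log(234)) whose graph Θ ⊆ ℝ², and a function f : ℝ² → ℝ, such that f is continuous on ℝ² with respect to the Euclidean metric, f is intrinsically Lipschitz continuous on ℝ² ∖ Θ (i.e., Lipschitz with respect to the intrinsic metric of ℝ² ∖ Θ), but f is not Lipschitz continuous on ℝ² with respect to the Euclidean metric. -/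
open Set
open scoped ENNReal NNReal Topology

/-- The intrinsic (pseudo-)metric of a subset `E` of a metric space: the infimum of the
lengths of paths from `x` to `y` that stay in `E` (`∞` if there is no such path). -/
noncomputable def intrinsicMetric {M : Type*} [PseudoEMetricSpace M]
    (E : Set M) (x y : M) : ℝ≥0∞ :=
  ⨅ (γ : ℝ → M) (_ : ContinuousOn γ (Set.Icc 0 1))
    (_ : Set.MapsTo γ (Set.Icc 0 1) E) (_ : γ 0 = x) (_ : γ 1 = y),
    eVariationOn γ (Set.Icc 0 1)

/-- The piecewise linear function with value `1` at `0` and support `[-1, 1]`. -/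
noncomputable def tent (y : ℝ) : ℝ := (|y + 1| + |y - 1|) / 2 - |y|

lemma continuous_tent : Continuous tent := by
  unfold tent; fun_prop

lemma tent_zero : tent 0 = 1 := by norm_num [tent]

lemma tent_eq_zero {y : ℝ} (hy : 1 ≤ |y|) : tent y = 0 := by
  unfold tent
  rcases le_abs.1 hy with h | h
  · rw [abs_of_nonneg (by linarith : 0 ≤ y + 1), abs_of_nonneg (by linarith : 0 ≤ y - 1),
      abs_of_nonneg (by linarith : 0 ≤ y)]
    ring
  · rw [abs_of_nonpos (by linarith : y + 1 ≤ 0), abs_of_nonpos (by linarith : y - 1 ≤ 0),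
      abs_of_nonpos (by linarith : y ≤ 0)]
    ring

lemma abs_tent_sub_le (a b : ℝ) : |tent a - tent b| ≤ 2 * |a - b| := by
  have h (c : ℝ) : |(|a + c| - |b + c|)| ≤ |a - b| := by
    simpa using abs_abs_sub_abs_le (a + c) (b + c)
  have h1 := abs_le.1 (h 1)
  have h2 := abs_le.1 (h (-1))
  have h3 := abs_le.1 (h 0)
  simp only [add_zero, ← sub_eq_add_neg] at h1 h2 h3
  unfold tent
  rw [abs_le]
  constructor <;> linarith [h1.1, h1.2, h2.1, h2.2, h3.1, h3.2]

lemma abs_tent_le_one (y : ℝ) : |tent y| ≤ 1 := by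
  unfold tent
  rw [abs_le]
  constructor
  · have := abs_add_le (y + 1) (y - 1)
    have h2 : |y + 1 + (y - 1)| = 2 * |y| := by
      rw [show y + 1 + (y - 1) = 2 * y by ring, abs_mul, abs_two]
    linarith
  · have h1 := abs_add_le y 1
    have h2 := abs_sub y 1
    rw [abs_one] at h1 h2
    linarith

/-- The retraction of the line onto `[0, 1]`. -/
noncomputable def unitRamp (x : ℝ) : ℝ := max 0 (min 1 x)

lemma continuous_unitRamp : Continuous unitRamp := by
  unfold unitRamp; fun_prop

lemma unitRamp_of_le_zero {x : ℝ} (hx : x ≤ 0) : unitRamp x = 0 :=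
  max_eq_left ((min_le_right _ _).trans hx)

lemma unitRamp_of_one_le {x : ℝ} (hx : 1 ≤ x) : unitRamp x = 1 := by
  simp [unitRamp, min_eq_left hx]

lemma abs_unitRamp_le_one (x : ℝ) : |unitRamp x| ≤ 1 := by
  rw [unitRamp, abs_of_nonneg (le_max_left _ _)]
  exact max_le zero_le_one (min_le_left _ _)

/-- A bump with value `1` on `[0, 1]` and support `[-1/2, 3/2]`. -/
noncomputable def plateau (v : ℝ) : ℝ := max 0 (min 1 (2 - 2 * |v - 1 / 2|))

lemma plateau_of_mem {v : ℝ} (h0 : 0 ≤ v) (h1 : v ≤ 1) : plateau v = 1 := by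
  have : |v - 1 / 2| ≤ 1 / 2 := abs_le.2 ⟨by linarith, by linarith⟩
  rw [plateau, min_eq_left (by linarith)]
  simp

lemma plateau_eq_zero {v : ℝ} (h : v ≤ -1 ∨ 2 ≤ v) : plateau v = 0 := by
  have : 1 ≤ |v - 1 / 2| := by
    rcases h with h | h
    · exact le_abs.2 (Or.inr (by linarith))
    · exact le_abs.2 (Or.inl (by linarith))
  exact max_eq_left ((min_le_right _ _).trans (by linarith))

lemma abs_plateau_le_one (v : ℝ) : |plateau v| ≤ 1 := by
  rw [plateau, abs_of_nonneg (le_max_left _ _)]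
  exact max_le zero_le_one (min_le_left _ _)

lemma abs_plateau_sub_le (u v : ℝ) : |plateau u - plateau v| ≤ 2 * |u - v| := by
  have h1 : |(2 - 2 * |u - 1 / 2|) - (2 - 2 * |v - 1 / 2|)| ≤ 2 * |u - v| := by
    have := abs_le.1 (abs_abs_sub_abs_le (u - 1 / 2) (v - 1 / 2))
    rw [sub_sub_sub_cancel_right] at this
    exact abs_le.2 ⟨by linarith [this.1, this.2], by linarith [this.1, this.2]⟩
  refine le_trans ?_ h1
  unfold plateau
  refine (abs_max_sub_max_le_max _ _ _ _).trans (max_le (by simp) ?_)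
  exact (abs_min_sub_min_le_max _ _ _ _).trans (max_le (by simp) le_rfl)

/-- The sequence of integers `a - b`, with `(a, b)` running through `[0, M) × [0, M)`
periodically. -/
noncomputable def offset (M i : ℕ) : ℝ := ((i % M : ℕ) : ℝ) - ((i / M % M : ℕ) : ℝ)

lemma offset_zero (M : ℕ) : offset M 0 = 0 := by simp [offset]

lemma abs_offset_le {M : ℕ} (hM : 0 < M) (i : ℕ) : |offset M i| ≤ M - 1 := by
  have h1 : ((i % M : ℕ) : ℝ) + 1 ≤ M := by exact_mod_cast Nat.mod_lt i hM
  have h2 : ((i / M % M : ℕ) : ℝ) + 1 ≤ M := by exact_mod_cast Nat.mod_lt (i / M) hM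
  have h3 : (0 : ℝ) ≤ ((i % M : ℕ) : ℝ) := Nat.cast_nonneg _
  have h4 : (0 : ℝ) ≤ ((i / M % M : ℕ) : ℝ) := Nat.cast_nonneg _
  rw [offset, abs_le]
  constructor <;> linarith

lemma sum_range_mul_mod_div {M : ℕ} (F : ℕ → ℕ → ℝ) (n : ℕ) :
    ∑ i ∈ Finset.range (M * n), F (i % M) (i / M) =
      ∑ b ∈ Finset.range n, ∑ a ∈ Finset.range M, F a b := by
  induction n with
  | zero => simp
  | succ n ih =>
    rw [Nat.mul_succ, Finset.sum_range_add, ih, Finset.sum_range_succ]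
    congr 1
    refine Finset.sum_congr rfl fun a ha => ?_
    have ha := Finset.mem_range.1 ha
    rw [Nat.mul_add_mod, Nat.mod_eq_of_lt ha, Nat.mul_add_div (by omega), Nat.div_eq_of_lt ha,
      add_zero]

lemma sum_sum_tent (M : ℕ) (z : ℝ) :
    ∑ b ∈ Finset.range M, ∑ a ∈ Finset.range M, tent (z - ((a : ℝ) - b)) =
      (|z + M| + |z - M|) / 2 - |z| := by
  have h1 (b : ℕ) : ∑ a ∈ Finset.range M, tent (z - ((a : ℝ) - b)) =
      (|z + ((b + 1 : ℕ) : ℝ)| / 2 - |z + ((b + 1 : ℕ) : ℝ) - M| / 2) -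
        (|z + (b : ℝ)| / 2 - |z + (b : ℝ) - M| / 2) := by
    have := Finset.sum_range_sub'
      (fun a : ℕ => (|z - a + b + 1| - |z - a + b|) / 2) M
    simp only [Nat.cast_zero] at this
    refine (Finset.sum_congr rfl fun a _ => ?_).trans (this.trans ?_)
    · unfold tent
      push_cast
      rw [show z - ((a : ℝ) - b) + 1 = z - a + b + 1 by ring,
        show z - ((a : ℝ) - b) - 1 = z - (a + 1) + b by ring,
        show z - ((a : ℝ) - b) = z - a + b by ring,
        show z - ((a : ℝ) + 1) + b + 1 = z - a + b by ring]
      ring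
    · push_cast
      rw [show z - 0 + (b : ℝ) + 1 = z + (b + 1) by ring, show z - 0 + (b : ℝ) = z + b by ring,
        show z - (M : ℝ) + b + 1 = z + (b + 1) - M by ring,
        show z - (M : ℝ) + b = z + b - M by ring]
      ring
  rw [Finset.sum_congr rfl fun b _ => h1 b,
    Finset.sum_range_sub (fun b : ℕ => |z + (b : ℝ)| / 2 - |z + (b : ℝ) - M| / 2)]
  simp only [Nat.cast_zero, add_zero, add_sub_cancel_right]
  ring

lemma sum_tent_offset {M : ℕ} (hM : 0 < M) (y : ℝ) :
    ∑ i ∈ Finset.range (2 * M ^ 2), tent (M * y - offset M i) = 2 * M * tent y := by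
  have hM' : (0 : ℝ) < M := by exact_mod_cast hM
  have h := sum_range_mul_mod_div (M := M)
    (fun a b => tent (M * y - ((a : ℝ) - ((b % M : ℕ) : ℝ)))) (M * 2)
  have h2 := sum_range_mul_mod_div (M := M)
    (fun b _ => ∑ a ∈ Finset.range M, tent (M * y - ((a : ℝ) - (b : ℝ)))) 2
  rw [h2] at h
  rw [show 2 * M ^ 2 = M * (M * 2) by ring]
  unfold offset
  rw [h, Finset.sum_const, sum_sum_tent, Finset.card_range]
  unfold tent
  rw [show (M : ℝ) * y + M = M * (y + 1) by ring, show (M : ℝ) * y - M = M * (y - 1) by ring,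
    abs_mul, abs_mul, abs_mul, abs_of_pos hM']
  simp only [nsmul_eq_mul, Nat.cast_ofNat]
  ring

lemma abs_sum_le_card_mul {s t : Finset ℕ} {h : ℕ → ℝ} {B : ℝ}
    (h0 : ∀ j ∉ t, h j = 0) (hB : ∀ j, |h j| ≤ B) : |∑ j ∈ s, h j| ≤ t.card * B := by
  have hBnn : 0 ≤ B := (abs_nonneg _).trans (hB 0)
  calc |∑ j ∈ s, h j| = |∑ j ∈ s ∩ t, h j| := by
        congr 1
        refine (Finset.sum_subset Finset.inter_subset_left fun j hj hj' => h0 j fun hjt => ?_).symm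
        exact hj' (Finset.mem_inter.2 ⟨hj, hjt⟩)
    _ ≤ ∑ j ∈ s ∩ t, |h j| := Finset.abs_sum_le_sum_abs _ _
    _ ≤ ∑ _j ∈ s ∩ t, B := Finset.sum_le_sum fun j _ => hB j
    _ ≤ t.card * B := by
        rw [Finset.sum_const, nsmul_eq_mul]
        gcongr
        exact Finset.inter_subset_right

lemma exists_unique_active (v : ℝ) :
    ∃ i : ℕ, ∀ j : ℕ, j ≠ i → v - 2 * j ≤ 0 ∨ 1 ≤ v - 2 * j := by
  refine ⟨⌊v / 2⌋₊, fun j hj => ?_⟩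
  rcases lt_or_gt_of_ne hj with h | h
  · right
    have h1 : ((j + 1 : ℕ) : ℝ) ≤ v / 2 :=
      (Nat.le_floor_iff' (Nat.succ_ne_zero j)).1 h
    push_cast at h1
    linarith
  · left
    have := (Nat.floor_lt' (by omega)).1 h
    linarith

section Substitution

variable {Z : Type*}

/-- `q` vanishes unless its first argument lies in `(0, 1)`. -/
def VanishesOutside (q : ℝ → Z → ℝ) : Prop :=
  ∀ x z, (x ≤ 0 ∨ 1 ≤ x) → q x z = 0

/-- The operator placing `Q` rescaled copies of `q`, weighted by `w`, over the intervals
`[2 i / (2 Q), (2 i + 1) / (2 Q)]`. -/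
noncomputable def substitute (w : ℝ) (Q : ℕ) (φ : ℕ → Z → Z) (q : ℝ → Z → ℝ) : ℝ → Z → ℝ :=
  fun x z => w * ∑ i ∈ Finset.range Q, q (2 * Q * x - 2 * i) (φ i z)

/-- The Neumann series of `substitute`. -/
noncomputable def substSeries (w : ℝ) (Q : ℕ) (φ : ℕ → Z → Z) (q : ℝ → Z → ℝ) : ℝ → Z → ℝ :=
  fun x z => ∑' n, ((substitute w Q φ)^[n] q) x z

variable {w B C r : ℝ} {Q : ℕ} {φ : ℕ → Z → Z} {q : ℝ → Z → ℝ}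

lemma rescale_outside {x : ℝ} (hx : x ≤ 0 ∨ 1 ≤ x) {i : ℕ} (hi : i < Q) :
    2 * Q * x - 2 * i ≤ 0 ∧ x ≤ 0 ∨ 2 ≤ 2 * Q * x - 2 * i ∧ 1 ≤ x := by
  have hi' : (i : ℝ) + 1 ≤ Q := by exact_mod_cast hi
  have hi0 : (0 : ℝ) ≤ i := Nat.cast_nonneg i
  rcases hx with h | h
  · left; exact ⟨by nlinarith, h⟩
  · right; exact ⟨by nlinarith, h⟩

lemma VanishesOutside.substitute (hq : VanishesOutside q) :
    VanishesOutside (substitute w Q φ q) := by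
  intro x z hx
  rw [_root_.substitute, Finset.sum_eq_zero, mul_zero]
  intro i hi
  refine hq _ _ ?_
  rcases rescale_outside hx (Finset.mem_range.1 hi) with h | h
  · exact Or.inl h.1
  · exact Or.inr (by linarith [h.1])

lemma VanishesOutside.iterate (hq : VanishesOutside q) (n : ℕ) :
    VanishesOutside ((_root_.substitute w Q φ)^[n] q) := by
  induction n with
  | zero => exact hq
  | succ n ih => rw [Function.iterate_succ_apply']; exact ih.substitute

lemma abs_substitute_le (hw : 0 ≤ w) (hq : VanishesOutside q) (hB : ∀ x z, |q x z| ≤ B)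
    (x : ℝ) (z : Z) : |substitute w Q φ q x z| ≤ w * B := by
  obtain ⟨i, hi⟩ := exists_unique_active (2 * Q * x)
  have := abs_sum_le_card_mul (s := Finset.range Q) (t := {i})
    (h := fun j => q (2 * Q * x - 2 * j) (φ j z)) (B := B)
    (fun j hj => hq _ _ (hi j (by simpa using hj))) (fun j => hB _ _)
  rw [substitute, abs_mul, abs_of_nonneg hw]
  simp only [Finset.card_singleton, Nat.cast_one, one_mul] at this
  gcongr

lemma abs_iterate_le (hw : 0 ≤ w) (hq : VanishesOutside q) (hB : ∀ x z, |q x z| ≤ B)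
    (n : ℕ) : ∀ x z, |((substitute w Q φ)^[n] q) x z| ≤ B * w ^ n := by
  induction n with
  | zero => simpa using hB
  | succ n ih =>
    intro x z
    rw [Function.iterate_succ_apply']
    refine (abs_substitute_le hw (hq.iterate n) ih x z).trans (le_of_eq ?_)
    ring

lemma summable_substSeries (hw : 0 ≤ w) (hw1 : w < 1) (hq : VanishesOutside q)
    (hB : ∀ x z, |q x z| ≤ B) (x : ℝ) (z : Z) :
    Summable fun n => ((substitute w Q φ)^[n] q) x z :=
  Summable.of_norm_bounded ((summable_geometric_of_lt_one hw hw1).mul_left B)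
    fun n => abs_iterate_le hw hq hB n x z

lemma substSeries_eq (hw : 0 ≤ w) (hw1 : w < 1) (hq : VanishesOutside q)
    (hB : ∀ x z, |q x z| ≤ B) (x : ℝ) (z : Z) :
    substSeries w Q φ q x z = q x z + substitute w Q φ (substSeries w Q φ q) x z := by
  have hs := fun x z => summable_substSeries (Q := Q) (φ := φ) hw hw1 hq hB x z
  rw [substSeries, (hs x z).tsum_eq_zero_add]
  congr 1
  simp only [Function.iterate_succ_apply']
  conv_rhs => rw [substitute]
  simp only [substSeries]
  rw [← Summable.tsum_finsetSum fun i _ => hs _ _, ← tsum_mul_left]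
  rfl

lemma VanishesOutside.substSeries (hq : VanishesOutside q) :
    VanishesOutside (substSeries w Q φ q) := by
  intro x z hx
  simp only [_root_.substSeries, hq.iterate _ x z hx, tsum_zero]

lemma continuous_substSeries [TopologicalSpace Z] (hw : 0 ≤ w) (hw1 : w < 1)
    (hφ : ∀ i, Continuous (φ i)) (hqc : Continuous (Function.uncurry q)) (hq : VanishesOutside q)
    (hB : ∀ x z, |q x z| ≤ B) : Continuous (Function.uncurry (substSeries w Q φ q)) := by
  have hc (n : ℕ) : Continuous (Function.uncurry ((substitute w Q φ)^[n] q)) := by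
    induction n with
    | zero => exact hqc
    | succ n ih =>
      rw [Function.iterate_succ_apply']
      refine continuous_const.mul (continuous_finsetSum _ fun i _ => ?_)
      exact ih.comp (f := fun p : ℝ × Z => ((2 * Q * p.1 - 2 * i : ℝ), φ i p.2))
        ((by fun_prop : Continuous fun p : ℝ × Z => (2 * Q * p.1 - 2 * i : ℝ)).prodMk
          ((hφ i).comp continuous_snd))
  exact continuous_tsum hc ((summable_geometric_of_lt_one hw hw1).mul_left B)
    fun n p => abs_iterate_le hw hq hB n p.1 p.2

lemma abs_substSeries_sub_le (hw : 0 ≤ w) (hw1 : w < 1) (hq : VanishesOutside q)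
    (hB : ∀ x z, |q x z| ≤ B) (hr : 0 ≤ r) (hr1 : r < 1) {x x' : ℝ} {z z' : Z}
    (h : ∀ n, |((substitute w Q φ)^[n] q) x z - ((substitute w Q φ)^[n] q) x' z'| ≤ C * r ^ n) :
    |substSeries w Q φ q x z - substSeries w Q φ q x' z'| ≤ C * (1 - r)⁻¹ := by
  have hs := fun x z => summable_substSeries (Q := Q) (φ := φ) hw hw1 hq hB x z
  rw [substSeries, substSeries, ← (hs x z).tsum_sub (hs x' z')]
  rw [← Real.norm_eq_abs]
  exact tsum_of_norm_bounded ((hasSum_geometric_of_lt_one hr hr1).mul_left C) h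

lemma abs_substSeries_sub_le_dist [PseudoMetricSpace Z] {M : ℝ} (hw : 0 ≤ w) (hw1 : w < 1)
    (hM : 0 ≤ M) (hwM : w * M < 1)
    (hφ : ∀ i z z', dist (φ i z) (φ i z') ≤ M * dist z z') (hq : VanishesOutside q)
    (hB : ∀ x z, |q x z| ≤ B) (hC : 0 ≤ C) (hL : ∀ x z z', |q x z - q x z'| ≤ C * dist z z')
    (x : ℝ) (z z' : Z) :
    |substSeries w Q φ q x z - substSeries w Q φ q x z'| ≤ C * (1 - w * M)⁻¹ * dist z z' := by
  have key (n : ℕ) : ∀ x z z', |((substitute w Q φ)^[n] q) x z - ((substitute w Q φ)^[n] q) x z'|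
      ≤ C * (w * M) ^ n * dist z z' := by
    induction n with
    | zero => simpa using hL
    | succ n ih =>
      intro x z z'
      rw [Function.iterate_succ_apply']
      set u := (substitute w Q φ)^[n] q with hu
      have hv : VanishesOutside u := hq.iterate n
      obtain ⟨i, hi⟩ := exists_unique_active (2 * Q * x)
      have := abs_sum_le_card_mul (s := Finset.range Q) (t := {i})
        (h := fun j => u (2 * Q * x - 2 * j) (φ j z) - u (2 * Q * x - 2 * j) (φ j z'))
        (B := C * (w * M) ^ n * (M * dist z z'))
        (fun j hj => by
          have hj := hi j (by simpa using hj)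
          simp only [hv _ _ hj, sub_self])
        (fun j => (ih _ _ _).trans (by gcongr; exact hφ j z z'))
      simp only [Finset.card_singleton, Nat.cast_one, one_mul] at this
      rw [substitute, substitute, ← mul_sub, ← Finset.sum_sub_distrib, abs_mul, abs_of_nonneg hw]
      calc w * _ ≤ w * (C * (w * M) ^ n * (M * dist z z')) := by gcongr
        _ = _ := by ring
  refine (abs_substSeries_sub_le (C := C * dist z z') (r := w * M) hw hw1 hq hB (by positivity)
    hwM fun n => (key n x z z').trans (le_of_eq (by ring))).trans (le_of_eq (by ring))

lemma abs_substSeries_sub_le_rpow {α : ℝ} (hw : 0 ≤ w) (hw1 : w < 1)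
    (hwα : 2 * w * (2 * Q : ℝ) ^ α < 1) (hq : VanishesOutside q)
    (hB : ∀ x z, |q x z| ≤ B) (hL : ∀ x x' z, |q x z - q x' z| ≤ C * |x - x'| ^ α)
    (x x' : ℝ) (z : Z) :
    |substSeries w Q φ q x z - substSeries w Q φ q x' z| ≤
      C * (1 - 2 * w * (2 * Q : ℝ) ^ α)⁻¹ * |x - x'| ^ α := by
  have key (n : ℕ) : ∀ x x' z, |((substitute w Q φ)^[n] q) x z - ((substitute w Q φ)^[n] q) x' z|
      ≤ C * (2 * w * (2 * Q : ℝ) ^ α) ^ n * |x - x'| ^ α := by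
    induction n with
    | zero => simpa using hL
    | succ n ih =>
      intro x x' z
      rw [Function.iterate_succ_apply']
      set u := (substitute w Q φ)^[n] q with hu
      have hv : VanishesOutside u := hq.iterate n
      obtain ⟨i, hi⟩ := exists_unique_active (2 * Q * x)
      obtain ⟨i', hi'⟩ := exists_unique_active (2 * Q * x')
      have hscale (j : ℕ) : |(2 * Q * x - 2 * j) - (2 * Q * x' - 2 * j)| ^ α =
          (2 * Q : ℝ) ^ α * |x - x'| ^ α := by
        rw [show (2 * Q * x - 2 * j) - (2 * Q * x' - 2 * j) = 2 * Q * (x - x') by ring, abs_mul,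
          abs_of_nonneg (by positivity : (0 : ℝ) ≤ 2 * Q),
          Real.mul_rpow (by positivity) (abs_nonneg _)]
      have := abs_sum_le_card_mul (s := Finset.range Q) (t := {i, i'})
        (h := fun j => u (2 * Q * x - 2 * j) (φ j z) - u (2 * Q * x' - 2 * j) (φ j z))
        (B := C * (2 * w * (2 * Q : ℝ) ^ α) ^ n * ((2 * Q : ℝ) ^ α * |x - x'| ^ α))
        (fun j hj => by
          have hj : j ≠ i ∧ j ≠ i' := by simpa using hj
          simp only [hv _ _ (hi j hj.1), hv _ _ (hi' j hj.2), sub_self])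
        (fun j => by rw [← hscale j]; exact ih _ _ _)
      have hnn := (abs_nonneg _).trans (ih (2 * Q * x - 2 * 0) (2 * Q * x' - 2 * 0) z)
      have hs0 := hscale 0
      rw [Nat.cast_zero] at hs0
      rw [hs0] at hnn
      have hcard : ((({i, i'} : Finset ℕ).card : ℕ) : ℝ) ≤ 2 := by
        exact_mod_cast Finset.card_le_two
      rw [substitute, substitute, ← mul_sub, ← Finset.sum_sub_distrib, abs_mul, abs_of_nonneg hw]
      calc w * _ ≤ w * (2 * (C * (2 * w * (2 * Q : ℝ) ^ α) ^ n *
              ((2 * Q : ℝ) ^ α * |x - x'| ^ α))) :=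
            mul_le_mul_of_nonneg_left (this.trans (mul_le_mul_of_nonneg_right hcard hnn)) hw
        _ = _ := by ring
  refine (abs_substSeries_sub_le (C := C * |x - x'| ^ α) (r := 2 * w * (2 * Q : ℝ) ^ α) hw hw1
    hq hB (by positivity) hwα fun n => (key n x x' z).trans (le_of_eq (by ring))).trans
    (le_of_eq (by ring))

end Substitution

/-- A Hölder function on the line obtained by stacking, over `2 M ^ 2` intervals of length
`1 / (4 M ^ 2)`, copies of itself scaled by `1 / M` at the heights `offset M i / M`. -/
lemma exists_holder_selfSimilar {M : ℕ} (hM : 1 < M) {α : ℝ} (hα : 0 ≤ α) (hα1 : α ≤ 1)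
    (h : 2 * (1 / M : ℝ) * (2 * (2 * M ^ 2 : ℕ) : ℝ) ^ α < 1) :
    ∃ θ : ℝ → ℝ, (∃ C, 0 < C ∧ ∀ s t, |θ s - θ t| ≤ C * |s - t| ^ α) ∧ θ 0 = 0 ∧
      ∀ i < 2 * M ^ 2, ∀ x : ℝ, 0 ≤ 2 * (2 * M ^ 2 : ℕ) * x - 2 * i →
        2 * (2 * M ^ 2 : ℕ) * x - 2 * i ≤ 1 →
          M * θ x = offset M i + θ (2 * (2 * M ^ 2 : ℕ) * x - 2 * i) := by
  have hM0 : (0 : ℝ) < M := by exact_mod_cast (by omega : 0 < M)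
  have hM1 : (1 : ℝ) < M := by exact_mod_cast hM
  set Q := 2 * M ^ 2 with hQ
  set c : ℕ → ℝ := fun i => offset M i / M with hc
  have hcb (i : ℕ) : |c i| ≤ 1 := by
    rw [hc, abs_div, abs_of_pos hM0, div_le_one hM0]
    linarith [abs_offset_le (by omega : 0 < M) i]
  set p : ℝ → ℝ := fun x => ∑ i ∈ Finset.range Q, c i * plateau (2 * Q * x - 2 * i) with hp
  have hpb (x : ℝ) : |p x| ≤ Q := by
    refine (Finset.abs_sum_le_sum_abs _ _).trans ?_
    refine (Finset.sum_le_card_nsmul _ _ 1 fun i _ => ?_).trans (by simp)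
    rw [abs_mul]
    exact mul_le_one₀ (hcb i) (abs_nonneg _) (abs_plateau_le_one _)
  have hpl (x x' : ℝ) : |p x - p x'| ≤ 4 * Q ^ 2 * |x - x'| := by
    rw [hp]
    simp only
    rw [← Finset.sum_sub_distrib]
    refine (Finset.abs_sum_le_sum_abs _ _).trans ?_
    refine (Finset.sum_le_card_nsmul _ _ (4 * Q * |x - x'|) fun i _ => ?_).trans
      (le_of_eq (by simp; ring))
    rw [← mul_sub, abs_mul]
    have h1 := abs_plateau_sub_le (2 * Q * x - 2 * i) (2 * Q * x' - 2 * i)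
    rw [show (2 * Q * x - 2 * i) - (2 * Q * x' - 2 * i) = 2 * Q * (x - x') by ring, abs_mul,
      abs_of_nonneg (by positivity : (0 : ℝ) ≤ 2 * Q)] at h1
    calc |c i| * _ ≤ 1 * (2 * (2 * Q * |x - x'|)) :=
          mul_le_mul (hcb i) h1 (abs_nonneg _) zero_le_one
      _ = _ := by ring
  have hpv : VanishesOutside fun x (_ : Unit) => p x := by
    intro x _ hx
    refine Finset.sum_eq_zero fun i hi => ?_
    rcases rescale_outside hx (Finset.mem_range.1 hi) with h | h
    · rcases Nat.eq_zero_or_pos i with rfl | hi0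
      · simp [hc, offset_zero]
      · have : (1 : ℝ) ≤ i := by exact_mod_cast hi0
        have : 2 * (Q : ℝ) * x ≤ 0 := mul_nonpos_of_nonneg_of_nonpos (by positivity) h.2
        rw [plateau_eq_zero (Or.inl (by linarith)), mul_zero]
    · rw [plateau_eq_zero (Or.inr h.1), mul_zero]
  have hph (x x' : ℝ) : |p x - p x'| ≤ (4 * Q ^ 2 + 2 * Q) * |x - x'| ^ α := by
    rcases le_total |x - x'| 1 with h1 | h1
    · have : |x - x'| ≤ |x - x'| ^ α := by
        simpa using Real.rpow_le_rpow_of_exponent_ge' (abs_nonneg _) h1 hα hα1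
      calc |p x - p x'| ≤ 4 * Q ^ 2 * |x - x'| := hpl x x'
        _ ≤ (4 * Q ^ 2 + 2 * Q) * |x - x'| ^ α := by
          gcongr
          linarith [(Nat.cast_nonneg Q : (0 : ℝ) ≤ Q)]
    · have h2 : 1 ≤ |x - x'| ^ α := Real.one_le_rpow h1 hα
      calc |p x - p x'| ≤ |p x| + |p x'| := abs_sub _ _
        _ ≤ (4 * Q ^ 2 + 2 * Q) * 1 := by nlinarith [hpb x, hpb x', sq_nonneg (Q : ℝ)]
        _ ≤ _ := by gcongr
  have hw : (0 : ℝ) ≤ 1 / M := by positivity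
  have hw1 : (1 / M : ℝ) < 1 := by rw [div_lt_one hM0]; exact hM1
  set g := substSeries (1 / M : ℝ) Q (fun _ => id) (fun x (_ : Unit) => p x) with hg
  have hgv : VanishesOutside g := hpv.substSeries
  have hQ0 : (0 : ℝ) < Q := by rw [hQ]; exact_mod_cast (by positivity)
  refine ⟨fun x => g x (), ⟨_, ?_, fun s t => abs_substSeries_sub_le_rpow hw hw1 h hpv
    (fun x _ => hpb x) (fun x x' _ => hph x x') s t ()⟩, hgv 0 () (Or.inl le_rfl), ?_⟩
  · have := inv_pos.2 (sub_pos.2 h)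
    positivity
  intro i hi x h0 h1
  have hother (j : ℕ) (hj : j ≠ i) : 2 * Q * x - 2 * j ≤ -1 ∨ 2 ≤ 2 * Q * x - 2 * (j : ℝ) := by
    rcases lt_or_gt_of_ne hj with h | h
    · have : (j : ℝ) + 1 ≤ i := by exact_mod_cast h
      right; linarith
    · have : (i : ℝ) + 1 ≤ j := by exact_mod_cast h
      left; linarith
  have hpx : p x = c i := by
    rw [hp]
    simp only
    rw [Finset.sum_eq_single i (fun j _ hj => by rw [plateau_eq_zero (hother j hj), mul_zero])
      (fun hn => absurd (Finset.mem_range.2 hi) hn), plateau_of_mem h0 h1, mul_one]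
  have hgx := substSeries_eq (Q := Q) (φ := fun _ => id) hw hw1 hpv (fun x _ => hpb x) x ()
  rw [← hg, substitute, Finset.sum_eq_single i (fun j _ hj => hgv _ _ (by
      rcases hother j hj with h | h
      · exact Or.inl (by linarith)
      · exact Or.inr (by linarith))) (fun hn => absurd (Finset.mem_range.2 hi) hn), hpx] at hgx
  simp only [id] at hgx
  simp only
  rw [hgx, hc]
  field_simp

/-- A continuous function, `0` to the left of the strip `[0, 1] × ℝ` and `tent y` to its right,
which is a sum of rescaled copies of itself over the same intervals as in
`exists_holder_selfSimilar`. -/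
lemma exists_refinable {M : ℕ} (hM : 0 < M) :
    ∃ f : ℝ → ℝ → ℝ, Continuous (Function.uncurry f) ∧
      (∀ x y, f x y = 1 / (2 * M) * ∑ i ∈ Finset.range (2 * M ^ 2),
        f (2 * (2 * M ^ 2 : ℕ) * x - 2 * i) (M * y - offset M i)) ∧
      (∀ x y, x ≤ 0 → f x y = 0) ∧ (∀ x y, 1 ≤ x → f x y = tent y) ∧
      (∀ x y, 1 ≤ |y| → f x y = 0) ∧
      ∃ L, 0 ≤ L ∧ ∀ x y y', |f x y - f x y'| ≤ L * |y - y'| := by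
  have hM0 : (0 : ℝ) < M := by exact_mod_cast hM
  have hM1 : (1 : ℝ) ≤ M := by exact_mod_cast hM
  have hrefine := sum_tent_offset hM
  set Q := 2 * M ^ 2 with hQ
  set w : ℝ := 1 / (2 * M) with hw_def
  have hw : 0 ≤ w := by positivity
  have hwM : w * M = 1 / 2 := by rw [hw_def]; field_simp
  have hw1 : w < 1 := by nlinarith
  set φ : ℕ → ℝ → ℝ := fun i y => M * y - offset M i with hφ
  set b : ℝ → ℝ → ℝ := fun x y => unitRamp x * tent y with hb
  have hb0 (x y : ℝ) (hx : x ≤ 0) : b x y = 0 := by simp [hb, unitRamp_of_le_zero hx]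
  have hb1 (x y : ℝ) (hx : 1 ≤ x) : b x y = tent y := by simp [hb, unitRamp_of_one_le hx]
  have hbB (x y : ℝ) : |b x y| ≤ 1 := by
    rw [hb, abs_mul]
    exact mul_le_one₀ (abs_unitRamp_le_one x) (abs_nonneg _) (abs_tent_le_one y)
  have hbL (x y y' : ℝ) : |b x y - b x y'| ≤ 2 * |y - y'| := by
    rw [hb]
    simp only
    rw [← mul_sub, abs_mul]
    calc _ ≤ 1 * (2 * |y - y'|) :=
          mul_le_mul (abs_unitRamp_le_one x) (abs_tent_sub_le y y') (abs_nonneg _) zero_le_one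
      _ = _ := one_mul _
  have hbv (x y : ℝ) (hy : 1 ≤ |y|) : b x y = 0 := by simp [hb, tent_eq_zero hy]
  have hbc : Continuous (Function.uncurry b) :=
    (continuous_unitRamp.comp continuous_fst).mul (continuous_tent.comp continuous_snd)
  have hφy (i : ℕ) (y : ℝ) (hy : 1 ≤ |y|) : 1 ≤ |φ i y| := by
    have h1 := abs_offset_le hM i
    have h2 := abs_sub_abs_le_abs_sub (M * y) (offset M i)
    rw [abs_mul, abs_of_pos hM0] at h2
    simp only [hφ]
    nlinarith
  have hφl (i : ℕ) (y y' : ℝ) : dist (φ i y) (φ i y') ≤ M * dist y y' := by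
    rw [Real.dist_eq, Real.dist_eq, hφ]
    simp only
    rw [sub_sub_sub_cancel_right, ← mul_sub, abs_mul, abs_of_pos hM0]
  set q : ℝ → ℝ → ℝ := fun x y => substitute w Q φ b x y - b x y with hq
  have hqv : VanishesOutside q := by
    intro x y hx
    simp only [hq, substitute]
    rcases hx with hx | hx
    · rw [hb0 x y hx, Finset.sum_eq_zero, mul_zero, sub_zero]
      intro i hi
      refine hb0 _ _ (sub_nonpos.2 (le_trans ?_ (by positivity : (0 : ℝ) ≤ 2 * i)))
      exact mul_nonpos_of_nonneg_of_nonpos (by positivity : (0 : ℝ) ≤ 2 * Q) hx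
    · have : ∑ i ∈ Finset.range Q, b (2 * Q * x - 2 * i) (φ i y) = 2 * M * tent y := by
        rw [← hrefine]
        refine Finset.sum_congr rfl fun i hi => hb1 _ _ ?_
        rcases rescale_outside (Or.inr hx) (Finset.mem_range.1 hi) with h | h
        · linarith [h.2]
        · linarith [h.1]
      rw [this, hb1 x y hx, hw_def]
      field_simp
      ring
  have hqB (x y : ℝ) : |q x y| ≤ w * Q + 1 := by
    refine (abs_sub _ _).trans (add_le_add ?_ (hbB x y))
    rw [substitute, abs_mul, abs_of_nonneg hw]
    gcongr
    refine (Finset.abs_sum_le_sum_abs _ _).trans ?_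
    exact (Finset.sum_le_card_nsmul _ _ (1 : ℝ) fun i _ => hbB _ _).trans (by simp)
  have hqL (x y y' : ℝ) : |q x y - q x y'| ≤ (w * (Q * (2 * M)) + 2) * dist y y' := by
    simp only [hq]
    rw [sub_sub_sub_comm, add_mul]
    refine (abs_sub _ _).trans (add_le_add ?_ (hbL x y y'))
    rw [substitute, substitute, ← mul_sub, ← Finset.sum_sub_distrib, abs_mul, abs_of_nonneg hw,
      mul_assoc w]
    refine mul_le_mul_of_nonneg_left ?_ hw
    refine (Finset.abs_sum_le_sum_abs _ _).trans ?_
    refine (Finset.sum_le_card_nsmul _ _ (2 * (M * dist y y')) fun i _ => ?_).trans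
      (le_of_eq (by simp; ring))
    refine (hbL _ _ _).trans ?_
    gcongr
    exact hφl i y y'
  have hqc : Continuous (Function.uncurry q) := by
    refine Continuous.sub (continuous_const.mul (continuous_finsetSum _ fun i _ => ?_)) hbc
    exact hbc.comp (f := fun p : ℝ × ℝ => ((2 * Q * p.1 - 2 * i : ℝ), φ i p.2))
      (by simp only [hφ]; fun_prop)
  set g := substSeries w Q φ q with hg
  have hgv : VanishesOutside g := hqv.substSeries
  have hgy (x y : ℝ) (hy : 1 ≤ |y|) : g x y = 0 := by
    have key (n : ℕ) : ∀ x y, 1 ≤ |y| → ((substitute w Q φ)^[n] q) x y = 0 := by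
      induction n with
      | zero =>
        intro x y hy
        simp only [Function.iterate_zero, id, hq, substitute, hbv x y hy, sub_zero]
        rw [Finset.sum_eq_zero fun i _ => hbv _ _ (hφy i y hy), mul_zero]
      | succ n ih =>
        intro x y hy
        rw [Function.iterate_succ_apply', substitute,
          Finset.sum_eq_zero fun i _ => ih _ _ (hφy i y hy), mul_zero]
    simp only [hg, substSeries, key _ x y hy, tsum_zero]
  refine ⟨fun x y => b x y + g x y, ?_, fun x y => ?_, fun x y hx => ?_, fun x y hx => ?_,
    fun x y hy => ?_, 2 + (w * (Q * (2 * M)) + 2) * (1 - w * M)⁻¹, ?_, fun x y y' => ?_⟩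
  · exact hbc.add (continuous_substSeries hw hw1 (fun i => by simp only [hφ]; fun_prop) hqc hqv hqB)
  · have := substSeries_eq (Q := Q) (φ := φ) hw hw1 hqv hqB x y
    rw [← hg] at this
    simp only [this]
    simp only [hq, substitute, hφ]
    rw [Finset.sum_add_distrib]
    ring
  · simp only [hb0 x y hx, hgv x y (Or.inl hx), add_zero]
  · simp only [hb1 x y hx, hgv x y (Or.inr hx), add_zero]
  · simp only [hbv x y hy, hgy x y hy, add_zero]
  · rw [hwM]; norm_num; positivity
  · have h1 := abs_substSeries_sub_le_dist (Q := Q) hw hw1 hM0.le (by rw [hwM]; norm_num) hφl hqv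
      hqB (by positivity) hqL x y y'
    rw [← hg, Real.dist_eq] at h1
    have h0 := hbL x y y'
    rw [add_sub_add_comm, add_mul]
    exact (abs_add_le _ _).trans (add_le_add h0 h1)

/-- A refinable function is locally constant in the first variable off the graph of the
corresponding self-similar function. -/
lemma eventually_eq_of_refinable {w N M R : ℝ} {Q : ℕ} {o : ℕ → ℝ} {f : ℝ → ℝ → ℝ} {θ : ℝ → ℝ}
    (hM : 1 < M)
    (hf : ∀ x y, f x y = w * ∑ i ∈ Finset.range Q, f (N * x - 2 * i) (M * y - o i))
    (hl : ∀ x x' y, x ≤ 0 → x' ≤ 0 → f x y = f x' y)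
    (hr : ∀ x x' y, 1 ≤ x → 1 ≤ x' → f x y = f x' y)
    (hv : ∀ x y, 1 ≤ |y| → f x y = 0)
    (hθ : ∀ i < Q, ∀ x, 0 ≤ N * x - 2 * i → N * x - 2 * i ≤ 1 →
      M * θ x = o i + θ (N * x - 2 * i))
    (hR : ∀ x, 0 ≤ x → x ≤ 1 → |θ x| ≤ R)
    {x y : ℝ} (h : 0 ≤ x → x ≤ 1 → y ≠ θ x) :
    ∀ᶠ z : ℝ × ℝ in 𝓝 (x, y), f z.1 z.2 = f x z.2 := by
  have hfst (x y : ℝ) : Filter.Tendsto Prod.fst (𝓝 (x, y)) (𝓝 x) := continuous_fst.tendsto _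
  have hsnd (x y : ℝ) : Filter.Tendsto Prod.snd (𝓝 (x, y)) (𝓝 y) := continuous_snd.tendsto _
  have houtside (x y : ℝ) (hx : x < 0 ∨ 1 < x) :
      ∀ᶠ z : ℝ × ℝ in 𝓝 (x, y), f z.1 z.2 = f x z.2 := by
    rcases hx with hx | hx
    · filter_upwards [(hfst x y).eventually (gt_mem_nhds hx)] with z hz
      exact hl _ _ _ hz.le hx.le
    · filter_upwards [(hfst x y).eventually (lt_mem_nhds hx)] with z hz
      exact hr _ _ _ hz.le hx.le
  have key (n : ℕ) : ∀ x y, (0 ≤ x → x ≤ 1 → R + 1 < M ^ n * |y - θ x|) →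
      ∀ᶠ z : ℝ × ℝ in 𝓝 (x, y), f z.1 z.2 = f x z.2 := by
    induction n with
    | zero =>
      intro x y h
      by_cases hx : x < 0 ∨ 1 < x
      · exact houtside x y hx
      push Not at hx
      have h1 := h hx.1 hx.2
      rw [pow_zero, one_mul] at h1
      have hy : 1 < |y| := by linarith [abs_sub y (θ x), hR x hx.1 hx.2]
      filter_upwards [(hsnd x y).eventually (continuous_abs.tendsto y |>.eventually
        (lt_mem_nhds hy))] with z hz
      rw [hv _ _ hz.le, hv _ _ hz.le]
    | succ n ih =>
      intro x y h
      by_cases hx : x < 0 ∨ 1 < x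
      · exact houtside x y hx
      push Not at hx
      have h1 : ∀ i ∈ Finset.range Q, ∀ᶠ z : ℝ × ℝ in 𝓝 (x, y),
          f (N * z.1 - 2 * i) (M * z.2 - o i) = f (N * x - 2 * i) (M * z.2 - o i) := by
        intro i hi
        have hc : Continuous fun z : ℝ × ℝ => (N * z.1 - 2 * i, M * z.2 - o i) := by fun_prop
        refine (hc.tendsto (x, y)).eventually (ih (N * x - 2 * i) (M * y - o i) fun h0 h1 => ?_)
        have hθx := hθ i (Finset.mem_range.1 hi) x h0 h1
        rw [show M * y - o i - θ (N * x - 2 * i) = M * (y - θ x) by rw [mul_sub, hθx]; ring,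
          abs_mul, abs_of_pos (by linarith : 0 < M), ← mul_assoc, ← pow_succ]
        exact h hx.1 hx.2
      filter_upwards [(Filter.eventually_all_finset _).2 h1] with z hz
      rw [hf z.1 z.2, hf x z.2, Finset.sum_congr rfl hz]
  by_cases hx : x < 0 ∨ 1 < x
  · exact houtside x y hx
  push Not at hx
  have hpos : 0 < |y - θ x| := abs_pos.2 (sub_ne_zero.2 (h hx.1 hx.2))
  obtain ⟨n, hn⟩ := pow_unbounded_of_one_lt ((R + 1) / |y - θ x|) hM
  exact key n x y fun _ _ => (div_lt_iff₀ hpos).1 hn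

/-- A function that is locally `L`-Lipschitz at every point of `E` is `L`-Lipschitz for the
intrinsic metric of `E`. -/
lemma edist_le_mul_intrinsicMetric {X Y : Type*} [PseudoEMetricSpace X] [PseudoEMetricSpace Y]
    {E : Set X} {f : X → Y} {L : ℝ≥0} (hL : L ≠ 0)
    (h : ∀ x ∈ E, ∃ U ∈ 𝓝 x, ∀ p ∈ U, ∀ q ∈ U, edist (f p) (f q) ≤ L * edist p q) (x y : X) :
    edist (f x) (f y) ≤ L * intrinsicMetric E x y := by
  rw [← ENNReal.div_le_iff' (by simpa using hL) ENNReal.coe_ne_top]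
  refine le_iInf fun γ => le_iInf fun hγ => le_iInf fun hE => le_iInf fun h0 => le_iInf fun h1 => ?_
  rw [ENNReal.div_le_iff' (by simpa using hL) ENNReal.coe_ne_top]
  choose! U hU hUL using h
  have hγ' : Continuous ((Icc (0 : ℝ) 1).domRestrict γ) := hγ.domRestrict
  obtain ⟨t, ht0, htm, ⟨m, hm⟩, htU⟩ := exists_monotone_Icc_subset_open_cover_Icc
    (zero_le_one' ℝ) (c := fun s : Icc (0 : ℝ) 1 => (Icc (0 : ℝ) 1).domRestrict γ ⁻¹'
      interior (U (γ s))) (fun s => isOpen_interior.preimage hγ') fun s _ =>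
      mem_iUnion.2 ⟨s, mem_interior_iff_mem_nhds.2 (hU _ (hE s.2))⟩
  have hstep (n : ℕ) : edist (f (γ (t n))) (f (γ (t (n + 1)))) ≤
      L * edist (γ (t (n + 1))) (γ (t n)) := by
    obtain ⟨s, hs⟩ := htU n
    rw [edist_comm (γ (t (n + 1)))]
    exact hUL _ (hE s.2) _ (interior_subset (hs (left_mem_Icc.2 (htm n.le_succ)))) _
      (interior_subset (hs (right_mem_Icc.2 (htm n.le_succ))))
  calc edist (f x) (f y) = edist (f (γ (t 0))) (f (γ (t m))) := by
        rw [ht0, hm m le_rfl, h0, h1]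
    _ ≤ ∑ n ∈ Finset.range m, edist (f (γ (t n))) (f (γ (t (n + 1)))) :=
        edist_le_range_sum_edist (fun n => f (γ (t n))) m
    _ ≤ ∑ n ∈ Finset.range m, L * edist (γ (t (n + 1))) (γ (t n)) :=
        Finset.sum_le_sum fun n _ => hstep n
    _ = L * ∑ n ∈ Finset.range m, edist (γ (t (n + 1))) (γ (t n)) := Finset.mul_sum .. |>.symm
    _ ≤ L * eVariationOn γ (Icc 0 1) := by
        gcongr
        exact eVariationOn.sum_le (u := fun n => (t n : ℝ)) (fun _ _ hab => htm hab)
          fun n => (t n).2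

lemma not_lipschitz_of_refinable {w N M : ℝ} {Q : ℕ} {o : ℕ → ℝ} {f : ℝ → ℝ → ℝ}
    (hN : 1 ≤ N) (hwN : 1 < w * N) (hQ : 0 < Q) (ho : o 0 = 0)
    (hf : ∀ x y, f x y = w * ∑ i ∈ Finset.range Q, f (N * x - 2 * i) (M * y - o i))
    (hl : ∀ x y, x ≤ 0 → f x y = 0) (h1 : f 1 0 = 1) (L : ℝ) :
    ∃ x, 0 ≤ x ∧ L * x < f x 0 := by
  have hN0 : 0 < N := by linarith
  have key (n : ℕ) : f (1 / N ^ n) 0 = w ^ n := by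
    induction n with
    | zero => simpa using h1
    | succ n ih =>
      have hx : N * (1 / N ^ (n + 1)) = 1 / N ^ n := by field_simp; ring
      have hx1 : 1 / N ^ n ≤ 1 := div_le_one_of_le₀ (one_le_pow₀ hN) (by positivity)
      rw [hf, hx, Finset.sum_eq_single 0, ho, pow_succ', ← ih]
      · simp
      · intro i _ hi
        have : (1 : ℝ) ≤ i := by exact_mod_cast Nat.one_le_iff_ne_zero.2 hi
        exact hl _ _ (by linarith)
      · exact fun hn => absurd (Finset.mem_range.2 hQ) hn
  obtain ⟨n, hn⟩ := pow_unbounded_of_one_lt L hwN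
  refine ⟨1 / N ^ n, by positivity, ?_⟩
  rw [key, mul_one_div, div_lt_iff₀ (by positivity), ← mul_pow]
  exact hn

lemma log_ten_div_log_bounds :
    1 / 3 ≤ Real.log 10 / Real.log 234 ∧ Real.log 10 / Real.log 234 ≤ 1 := by
  have h : 0 < Real.log 234 := Real.log_pos (by norm_num)
  refine ⟨?_, div_le_one_of_le₀ (Real.log_le_log (by norm_num) (by norm_num)) h.le⟩
  rw [le_div_iff₀ h]
  have h1 : Real.log 234 ≤ Real.log (10 ^ 3) := Real.log_le_log (by norm_num) (by norm_num)
  rw [Real.log_pow] at h1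
  push_cast at h1
  linarith

lemma two_mul_rpow_lt {α : ℝ} (hα : 1 / 3 ≤ α) (h : (234 : ℝ) ^ α = 10) :
    2 * (4 * 10 ^ 10 : ℝ) ^ α < 10 ^ 5 := by
  have h2 : (2 : ℝ) ≤ 8 ^ α := by
    calc (2 : ℝ) = (2 ^ (3 : ℝ)) ^ (1 / 3 : ℝ) := by
          rw [← Real.rpow_mul (by norm_num)]; norm_num
      _ = 8 ^ (1 / 3 : ℝ) := by norm_num
      _ ≤ 8 ^ α := Real.rpow_le_rpow_of_exponent_le (by norm_num) hα
  calc 2 * (4 * 10 ^ 10 : ℝ) ^ α ≤ 8 ^ α * (4 * 10 ^ 10 : ℝ) ^ α := by gcongr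
    _ = (8 * (4 * 10 ^ 10) : ℝ) ^ α := (Real.mul_rpow (by norm_num) (by norm_num)).symm
    _ < ((234 : ℝ) ^ 5) ^ α :=
        Real.rpow_lt_rpow (by norm_num) (by norm_num) (by linarith)
    _ = 10 ^ 5 := by rw [← h, Real.rpow_pow_comm (by norm_num)]

/-- There exist a Hölder continuous function `θ : [0,1] → ℝ` with
exponent `log 10 / log 234` (with graph `Θ ⊆ ℝ²`) and a function `f : ℝ² → ℝ` which is
continuous, intrinsically Lipschitz continuous on `ℝ² ∖ Θ`, but not Lipschitz continuous
with respect to the Euclidean metric. -/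
theorem exists_intrinsically_lipschitz_not_lipschitz :
    ∃ θ : ℝ → ℝ,
      (∃ C : ℝ, 0 < C ∧ ∀ s ∈ Set.Icc (0:ℝ) 1, ∀ t ∈ Set.Icc (0:ℝ) 1,
        |θ s - θ t| ≤ C * |s - t| ^ (Real.log 10 / Real.log 234)) ∧
      ∃ f : EuclideanSpace ℝ (Fin 2) → ℝ,
        Continuous f ∧
        (∃ L : ℝ≥0, ∀ x ∈ ({p : EuclideanSpace ℝ (Fin 2) |
              p 0 ∈ Set.Icc (0:ℝ) 1 ∧ p 1 = θ (p 0)})ᶜ,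
            ∀ y ∈ ({p : EuclideanSpace ℝ (Fin 2) |
              p 0 ∈ Set.Icc (0:ℝ) 1 ∧ p 1 = θ (p 0)})ᶜ,
            edist (f x) (f y) ≤ (L : ℝ≥0∞) *
              intrinsicMetric ({p : EuclideanSpace ℝ (Fin 2) |
                p 0 ∈ Set.Icc (0:ℝ) 1 ∧ p 1 = θ (p 0)})ᶜ x y) ∧
        ¬ ∃ L : ℝ≥0, LipschitzWith L f := by
  obtain ⟨hα, hα1⟩ := log_ten_div_log_bounds
  have hα234 : (234 : ℝ) ^ (Real.log 10 / Real.log 234) = 10 := by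
    rw [Real.log_div_log]
    exact Real.rpow_logb (by norm_num) (by norm_num) (by norm_num)
  set α := Real.log 10 / Real.log 234
  obtain ⟨M, hM⟩ : ∃ M : ℕ, M = 10 ^ 5 := ⟨_, rfl⟩
  have hMr : (M : ℝ) = 10 ^ 5 := by rw [hM]; norm_num
  have hM1 : 1 < M := by rw [hM]; norm_num
  have hN : (2 * (2 * M ^ 2 : ℕ) : ℝ) = 4 * 10 ^ 10 := by push_cast; rw [hMr]; norm_num
  obtain ⟨θ, ⟨C, hC, hθC⟩, hθ0, hθ⟩ := exists_holder_selfSimilar hM1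
    (by linarith : 0 ≤ α) hα1 (by
      rw [hN, hMr, mul_one_div, div_mul_eq_mul_div, div_lt_one (by norm_num)]
      exact two_mul_rpow_lt hα hα234)
  obtain ⟨f, hfc, hf, hl, hr, hv, L, hL, hfL⟩ := exists_refinable (by omega : 0 < M)
  refine ⟨θ, ⟨C, hC, fun s _ t _ => hθC s t⟩, fun p => f (p 0) (p 1), ?_,
    ⟨L.toNNReal + 1, fun x _ y _ => ?_⟩, ?_⟩
  · exact hfc.comp (f := fun p : EuclideanSpace ℝ (Fin 2) => (p 0, p 1)) (by fun_prop)
  · refine edist_le_mul_intrinsicMetric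
      (f := fun p : EuclideanSpace ℝ (Fin 2) => f (p 0) (p 1)) (by simp) (fun a ha => ?_) x y
    have hev := eventually_eq_of_refinable (by rw [hMr]; norm_num) hf
      (fun x x' y h h' => by rw [hl x y h, hl x' y h'])
      (fun x x' y h h' => by rw [hr x y h, hr x' y h']) hv hθ
      (R := C) (fun x h0 h1 => by
        have := hθC x 0
        rw [hθ0, sub_zero, sub_zero] at this
        refine this.trans (mul_le_of_le_one_right hC.le ?_)
        exact Real.rpow_le_one (abs_nonneg _) (abs_le.2 ⟨by linarith, h1⟩) (by linarith))
      (x := a 0) (y := a 1) fun h0 h1 h => ha ⟨⟨h0, h1⟩, h⟩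
    have hc : Continuous fun p : EuclideanSpace ℝ (Fin 2) => (p 0, p 1) := by fun_prop
    refine ⟨_, (hc.tendsto a).eventually hev, fun p hp q hq => ?_⟩
    have hp : f (p 0) (p 1) = f (a 0) (p 1) := hp
    have hq : f (q 0) (q 1) = f (a 0) (q 1) := hq
    simp only [hp, hq]
    rw [edist_dist, edist_dist, ← ENNReal.ofReal_coe_nnreal, ← ENNReal.ofReal_mul (by positivity)]
    refine ENNReal.ofReal_le_ofReal ?_
    rw [NNReal.coe_add, Real.coe_toNNReal _ hL, NNReal.coe_one, Real.dist_eq]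
    have h1 : |p 1 - q 1| ≤ dist p q := by
      rw [dist_eq_norm]
      exact PiLp.norm_apply_le (p - q) 1
    calc _ ≤ L * |p 1 - q 1| := hfL _ _ _
      _ ≤ (L + 1) * dist p q := by gcongr; linarith
  · rintro ⟨K, hK⟩
    obtain ⟨x, hx, hKx⟩ := not_lipschitz_of_refinable (w := 1 / (2 * M))
      (by rw [hN]; norm_num) (by rw [hN, hMr]; norm_num) (by positivity) (offset_zero M) hf hl
      (by rw [hr 1 0 le_rfl, tent_zero]) K
    have h := hK.dist_le_mul !₂[x, 0] !₂[0, 0]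
    rw [EuclideanSpace.dist_eq] at h
    simp [Real.dist_eq, hl 0 0 le_rfl, Real.sqrt_sq hx] at h
    linarith [le_abs_self (f x 0)]
end
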